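/- arXiv:2512.06398 — 6 statements merged into one kernel-verified Lean document; each statement's English description precedes it below -/
import Mathlib

section
/- Let v be a weight on [0,1), define w(r) := (1−r)v(r), and let g be a non-constant analytic function on 𝔻. Assume there is A > 0 such that every analytic h on 𝔻 with sup_{z∈𝔻} v(|z|)|h(z)| < ∞ satisfies sup_{z∈𝔻} w(|z|)|h'(z)| ≤ A · sup_{z∈𝔻} v(|z|)|h(z)|. Then for every r ∈ (0,1) there is a constant C > 0 such that every analytic f on 𝔻 with sup_{z∈𝔻} v(|z|)|(V_g f)(z)| < ∞ satisfies sup_{|u| ≤ r} |f(u)| ≤ C · sup_{z∈𝔻} v(|z|)|(V_g f)(z)|. -/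
open Metric ENNReal

/-- The generalized Volterra operator `(V_g f)(z) = ∫₀ᶻ f(ξ)g'(ξ)dξ = z·∫₀¹ f(sz)g'(sz) ds`. -/
noncomputable def Vg (g f : ℂ → ℂ) (z : ℂ) : ℂ :=
  z * ∫ s in (0:ℝ)..1, f ((s : ℂ) * z) * deriv g ((s : ℂ) * z)

/-- The weighted sup-"norm" `sup_{z ∈ 𝔻} v(|z|)·|f(z)|`, computed in `[0,∞]`. -/
noncomputable def wSup (v : ℝ → ℝ) (f : ℂ → ℂ) : ℝ≥0∞ :=
  ⨆ z ∈ ball (0:ℂ) 1, ENNReal.ofReal (v ‖z‖ * ‖f z‖)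

/-- For `f` and `g` analytic on the unit disc, `V_g f` is a primitive of `f * deriv g`. -/
lemma hasDerivAt_Vg {g f : ℂ → ℂ} (hg : DifferentiableOn ℂ g (ball (0:ℂ) 1))
    (hf : DifferentiableOn ℂ f (ball (0:ℂ) 1)) {z : ℂ} (hz : z ∈ ball (0:ℂ) 1) :
    HasDerivAt (Vg g f) (f z * deriv g z) z := by
  have hfg : DifferentiableOn ℂ (fun ξ => f ξ * deriv g ξ) (ball (0:ℂ) 1) :=
    hf.mul (hg.deriv isOpen_ball)
  obtain ⟨F, hF⟩ := hfg.isExactOn_ball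
  have hVF : Set.EqOn (Vg g f) (fun ζ => F ζ - F 0) (ball (0:ℂ) 1) := by
    intro ζ hζ
    have hmem : ∀ t ∈ Set.Icc (0:ℝ) 1, 0 + t • ζ ∈ ball (0:ℂ) 1 := fun t ht => by
      rw [zero_add]
      exact ((convex_ball (0:ℂ) 1).starConvex (mem_ball_self one_pos)).smul_mem hζ ht.1 ht.2
    have hint := intervalIntegral.integral_unitInterval_deriv_eq_sub (f := F)
      (f' := fun ξ => f ξ * deriv g ξ) (z₀ := 0) (z₁ := ζ)
      (hfg.continuousOn.comp (by fun_prop) hmem) (fun t ht => hF _ (hmem t ht))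
    simpa [Vg] using hint
  exact ((hF z hz).sub_const (F 0)).congr_of_eventuallyEq
    (hVF.eventuallyEq_of_mem (isOpen_ball.mem_nhds hz))

/-- A function which is analytic and not identically zero on the unit disc has no zeros on
circles centred at the origin of radius arbitrarily close to `1`. -/
lemma exists_sphere_forall_ne_zero {k : ℂ → ℂ} (hk : DifferentiableOn ℂ k (ball (0:ℂ) 1))
    (hk0 : ¬ Set.EqOn k 0 (ball (0:ℂ) 1)) {r : ℝ} (hr : r < 1) :
    ∃ ρ ∈ Set.Ioo r 1, ∀ z ∈ sphere (0:ℂ) ρ, k z ≠ 0 := by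
  obtain ⟨R, hrR, hR1⟩ := exists_between hr
  have hsub : closedBall (0:ℂ) R ⊆ ball 0 1 := closedBall_subset_ball hR1
  have hfin : {z ∈ closedBall (0:ℂ) R | k z = 0}.Finite := by
    by_contra hinf
    obtain ⟨x, hxR, hx⟩ := Set.Infinite.exists_accPt_of_subset_isCompact hinf
      (isCompact_closedBall (0:ℂ) R) (Set.sep_subset _ _)
    exact hk0 <| (hk.analyticOnNhd isOpen_ball).eqOn_zero_of_preconnected_of_frequently_eq_zero
      (convex_ball (0:ℂ) 1).isPreconnected (hsub hxR)
      ((accPt_iff_frequently_nhdsNE.1 hx).mono fun _ h => h.2)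
  obtain ⟨ρ, hρ, hρ'⟩ := (Set.Ioo_infinite hrR).exists_notMem_finite (hfin.image norm)
  refine ⟨ρ, ⟨hρ.1, hρ.2.trans hR1⟩, fun z hz hkz => hρ' ⟨z, ⟨?_, hkz⟩, by simpa using hz⟩⟩
  exact sphere_subset_closedBall.trans (closedBall_subset_closedBall hρ.2.le) hz

/-- A finite bound on the weighted supremum bounds the function pointwise. -/
lemma mul_norm_le_of_wSup_le {v : ℝ → ℝ} {f : ℂ → ℂ} {c : ℝ≥0∞} (hc : c ≠ ⊤)
    (h : wSup v f ≤ c) {z : ℂ} (hz : z ∈ ball (0:ℂ) 1) : v ‖z‖ * ‖f z‖ ≤ c.toReal :=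
  (ENNReal.ofReal_le_iff_le_toReal hc).1 ((le_iSup₂_of_le z hz le_rfl).trans h)

/-- Let `v` be a weight on `[0,1)`, `w(r) = (1-r)v(r)`, and `g` a non-constant
analytic function on `𝔻`. If the differentiation operator maps `H^∞_v` continuously into
`H^∞_w` (with constant `A`), then for every `r ∈ (0,1)` there is `C > 0` such that every
analytic `f` with `V_g f ∈ H^∞_v` satisfies `sup_{|u|≤r} |f(u)| ≤ C·‖V_g f‖_{∞,v}`; i.e. the
inclusion of the optimal domain `[V_g, H^∞_v]` into `H(𝔻)` is continuous. -/
theorem optimalDomain_inclusion_continuous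
    (v : ℝ → ℝ)
    (hvpos : ∀ r ∈ Set.Ico (0:ℝ) 1, 0 < v r)
    (hvcont : ContinuousOn v (Set.Ico (0:ℝ) 1))
    (hvanti : AntitoneOn v (Set.Ico (0:ℝ) 1))
    (g : ℂ → ℂ) (hg : DifferentiableOn ℂ g (ball (0:ℂ) 1))
    (hgnc : ∃ z ∈ ball (0:ℂ) 1, ∃ z' ∈ ball (0:ℂ) 1, g z ≠ g z')
    (A : ℝ) (hA : 0 < A)
    (hD : ∀ h : ℂ → ℂ, DifferentiableOn ℂ h (ball (0:ℂ) 1) →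
      wSup v h < ⊤ →
      wSup (fun r => (1 - r) * v r) (deriv h) ≤ ENNReal.ofReal A * wSup v h) :
    ∀ r ∈ Set.Ioo (0:ℝ) 1, ∃ C > 0, ∀ f : ℂ → ℂ,
      DifferentiableOn ℂ f (ball (0:ℂ) 1) →
      wSup v (Vg g f) < ⊤ →
      ∀ u : ℂ, ‖u‖ ≤ r →
        ‖f u‖ ≤ C * (wSup v (Vg g f)).toReal := by
  rintro r ⟨hr0, hr1⟩
  have hg' : DifferentiableOn ℂ (deriv g) (ball (0:ℂ) 1) := hg.deriv isOpen_ball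
  have hg'0 : ¬ Set.EqOn (deriv g) 0 (ball (0:ℂ) 1) := fun h => by
    obtain ⟨z, hz, z', hz', hne⟩ := hgnc
    exact hne (isOpen_ball.is_const_of_deriv_eq_zero (convex_ball (0:ℂ) 1).isPreconnected hg h
      hz hz')
  obtain ⟨ρ, ⟨hrρ, hρ1⟩, hne⟩ := exists_sphere_forall_ne_zero hg' hg'0 hr1
  have hρ0 : 0 < ρ := hr0.trans hrρ
  have hcb : closedBall (0:ℂ) ρ ⊆ ball 0 1 := closedBall_subset_ball hρ1
  have hsb : sphere (0:ℂ) ρ ⊆ ball 0 1 := sphere_subset_closedBall.trans hcb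
  obtain ⟨z₀, hz₀, hmin⟩ := (isCompact_sphere (0:ℂ) ρ).exists_isMinOn
    (NormedSpace.sphere_nonempty.2 hρ0.le) (hg'.continuousOn.mono hsb).norm
  have hm : 0 < ‖deriv g z₀‖ := norm_pos_iff.2 (hne z₀ hz₀)
  have hw : 0 < (1 - ρ) * v ρ := mul_pos (sub_pos.2 hρ1) (hvpos ρ ⟨hρ0.le, hρ1⟩)
  refine ⟨A / ((1 - ρ) * v ρ * ‖deriv g z₀‖), by positivity, fun f hf hfin u hu => ?_⟩
  have hV := hD (Vg g f)
    (fun z hz => (hasDerivAt_Vg hg hf hz).differentiableAt.differentiableWithinAt) hfin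
  have hbound : ∀ z ∈ sphere (0:ℂ) ρ,
      ‖f z‖ ≤ A / ((1 - ρ) * v ρ * ‖deriv g z₀‖) * (wSup v (Vg g f)).toReal := by
    intro z hz
    have hz_norm : ‖z‖ = ρ := by simpa using hz
    have h := mul_norm_le_of_wSup_le (ENNReal.mul_ne_top ENNReal.ofReal_ne_top hfin.ne) hV (hsb hz)
    rw [(hasDerivAt_Vg hg hf (hsb hz)).deriv, ENNReal.toReal_mul, ENNReal.toReal_ofReal hA.le,
      hz_norm, norm_mul] at h
    rw [div_mul_eq_mul_div, le_div_iff₀ (by positivity)]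
    calc ‖f z‖ * ((1 - ρ) * v ρ * ‖deriv g z₀‖)
        ≤ ‖f z‖ * ((1 - ρ) * v ρ * ‖deriv g z‖) := by gcongr; exact hmin hz
      _ = (1 - ρ) * v ρ * (‖f z‖ * ‖deriv g z‖) := by ring
      _ ≤ A * (wSup v (Vg g f)).toReal := h
  refine Complex.norm_le_of_forall_mem_frontier_norm_le (isBounded_ball (x := (0:ℂ)) (r := ρ))
    (hf.diffContOnCl_ball hcb) (fun z hz => hbound z ?_) (subset_closure ?_)
  · rwa [frontier_ball (0:ℂ) hρ0.ne'] at hz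
  · simpa using hu.trans_lt hrρ
end

section
/- Let v be a weight on [0,1), w(r) := (1−r)v(r), and assume: (D) there is A > 0 such that every analytic h on 𝔻 with sup_{z∈𝔻} v(|z|)|h(z)| < ∞ satisfies sup_{z∈𝔻} w(|z|)|h'(z)| ≤ A·sup_{z∈𝔻} v(|z|)|h(z)|; (J) there is B > 0 such that every analytic h on 𝔻 with sup_{z∈𝔻} w(|z|)|h(z)| < ∞ satisfies sup_{z∈𝔻} v(|z|)|∫₀ᶻ h(ξ)dξ| ≤ B·sup_{z∈𝔻} w(|z|)|h(z)|. Let g be analytic on 𝔻 with constants 0 < m ≤ |g'(z)| ≤ M for all z ∈ 𝔻. Then there exist c₁, c₂ > 0 such that for every analytic f on 𝔻 (suprema computed in [0,∞]): c₁·sup_{z∈𝔻} w(|z|)|f(z)| ≤ sup_{z∈𝔻} v(|z|)|(V_g f)(z)| ≤ c₂·sup_{z∈𝔻} w(|z|)|f(z)|. In particular, the optimal domain [V_g, H^∞_v] = {f analytic : sup v(|z|)|(V_g f)(z)| < ∞} coincides with H^∞_w = {f analytic : sup w(|z|)|f(z)| < ∞}. -/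
open Metric ENNReal

/-- The integration operator `(J h)(z) = ∫₀ᶻ h(ξ)dξ = z·∫₀¹ h(sz) ds`. -/
noncomputable def Jop (h : ℂ → ℂ) (z : ℂ) : ℂ :=
  z * ∫ s in (0:ℝ)..1, h ((s : ℂ) * z)

/-- On the unit disc, `Jop h` is a primitive of the holomorphic function `h`. -/
theorem hasDerivAt_Jop {h : ℂ → ℂ} (hh : DifferentiableOn ℂ h (ball (0:ℂ) 1)) {z : ℂ}
    (hz : z ∈ ball (0:ℂ) 1) : HasDerivAt (Jop h) (h z) z := by
  obtain ⟨F, hF0, hF⟩ := hh.isExactOn_ball.with_val_at 0 0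
  have hJF : ∀ x ∈ ball (0:ℂ) 1, Jop h x = F x := by
    intro x hx
    have hmem : ∀ s ∈ Set.uIcc (0:ℝ) 1, (s : ℂ) * x ∈ ball (0:ℂ) 1 := by
      intro s hs
      rw [Set.uIcc_of_le zero_le_one] at hs
      rw [mem_ball_zero_iff] at hx ⊢
      rw [norm_mul, Complex.norm_real, Real.norm_of_nonneg hs.1]
      exact (mul_le_of_le_one_left (norm_nonneg x) hs.2).trans_lt hx
    have hderiv : ∀ s ∈ Set.uIcc (0:ℝ) 1,
        HasDerivAt (fun s : ℝ => F ((s : ℂ) * x)) (h ((s : ℂ) * x) * x) s := by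
      intro s hs
      have hline : HasDerivAt (fun s : ℝ => (s : ℂ) * x) x s := by
        simpa using (Complex.ofRealCLM.hasDerivAt (x := s)).mul_const x
      exact (hF _ (hmem s hs)).comp s hline
    have hcont : ContinuousOn (fun s : ℝ => h ((s : ℂ) * x) * x) (Set.uIcc (0:ℝ) 1) :=
      (hh.continuousOn.comp (by fun_prop) hmem).mul continuousOn_const
    have hint := intervalIntegral.integral_eq_sub_of_hasDerivAt hderiv hcont.intervalIntegrable
    rw [intervalIntegral.integral_mul_const] at hint
    simpa [Jop, hF0, mul_comm] using hint
  refine (hF z hz).congr_of_eventuallyEq ?_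
  filter_upwards [isOpen_ball.mem_nhds hz] with x hx using hJF x hx

/-- A pointwise bound `‖f‖ ≤ C‖h‖` on the disc gives the same bound for weighted suprema. -/
theorem wSup_le_mul_wSup {v : ℝ → ℝ} (hv : ∀ r ∈ Set.Ico (0:ℝ) 1, 0 ≤ v r) {f h : ℂ → ℂ}
    {C : ℝ} (hC : 0 ≤ C) (hfh : ∀ z ∈ ball (0:ℂ) 1, ‖f z‖ ≤ C * ‖h z‖) :
    wSup v f ≤ ENNReal.ofReal C * wSup v h := by
  refine iSup₂_le fun z hz => ?_
  have hvz : 0 ≤ v ‖z‖ := hv _ ⟨norm_nonneg z, mem_ball_zero_iff.1 hz⟩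
  calc ENNReal.ofReal (v ‖z‖ * ‖f z‖)
      ≤ ENNReal.ofReal (C * (v ‖z‖ * ‖h z‖)) := by
        refine ENNReal.ofReal_le_ofReal ?_
        rw [mul_left_comm]
        exact mul_le_mul_of_nonneg_left (hfh z hz) hvz
    _ = ENNReal.ofReal C * ENNReal.ofReal (v ‖z‖ * ‖h z‖) := ENNReal.ofReal_mul hC
    _ ≤ ENNReal.ofReal C * wSup v h := by
        gcongr
        exact le_iSup₂ (f := fun z (_ : z ∈ ball (0:ℂ) 1) =>
          ENNReal.ofReal (v ‖z‖ * ‖h z‖)) z hz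

/-- Let `v` be a weight, `w(r) = (1-r)v(r)`, with `D : H^∞_v → H^∞_w` and
`J : H^∞_w → H^∞_v` continuous, and `g` analytic with `0 < m ≤ |g'| ≤ M` on `𝔻`. Then there
are `c₁, c₂ > 0` with `c₁·‖f‖_{∞,w} ≤ ‖V_g f‖_{∞,v} ≤ c₂·‖f‖_{∞,w}` for every analytic `f`
(suprema in `[0,∞]`); in particular `[V_g, H^∞_v] = H^∞_w`. -/
theorem optimalDomain_Vg_eq_Hw
    (v : ℝ → ℝ)
    (hvpos : ∀ r ∈ Set.Ico (0:ℝ) 1, 0 < v r)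
    (hvcont : ContinuousOn v (Set.Ico (0:ℝ) 1))
    (hvanti : AntitoneOn v (Set.Ico (0:ℝ) 1))
    (A : ℝ) (hA : 0 < A)
    (hD : ∀ h : ℂ → ℂ, DifferentiableOn ℂ h (ball (0:ℂ) 1) →
      wSup v h < ⊤ →
      wSup (fun r => (1 - r) * v r) (deriv h) ≤ ENNReal.ofReal A * wSup v h)
    (B : ℝ) (hB : 0 < B)
    (hJ : ∀ h : ℂ → ℂ, DifferentiableOn ℂ h (ball (0:ℂ) 1) →
      wSup (fun r => (1 - r) * v r) h < ⊤ →
      wSup v (Jop h) ≤ ENNReal.ofReal B * wSup (fun r => (1 - r) * v r) h)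
    (g : ℂ → ℂ) (hg : DifferentiableOn ℂ g (ball (0:ℂ) 1))
    (m M : ℝ) (hm : 0 < m)
    (hg' : ∀ z ∈ ball (0:ℂ) 1, m ≤ ‖deriv g z‖ ∧ ‖deriv g z‖ ≤ M) :
    ∃ c₁ > (0:ℝ), ∃ c₂ > (0:ℝ), ∀ f : ℂ → ℂ, DifferentiableOn ℂ f (ball (0:ℂ) 1) →
      (ENNReal.ofReal c₁ * wSup (fun r => (1 - r) * v r) f ≤ wSup v (Vg g f) ∧
        wSup v (Vg g f) ≤ ENNReal.ofReal c₂ * wSup (fun r => (1 - r) * v r) f) ∧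
      (wSup v (Vg g f) < ⊤ ↔ wSup (fun r => (1 - r) * v r) f < ⊤) := by
  have hM : 0 < M := by
    obtain ⟨h₁, h₂⟩ := hg' 0 (mem_ball_self one_pos)
    linarith
  have hw : ∀ r ∈ Set.Ico (0:ℝ) 1, 0 ≤ (fun r => (1 - r) * v r) r := fun r hr =>
    mul_nonneg (sub_nonneg.2 hr.2.le) (hvpos r hr).le
  refine ⟨m / A, div_pos hm hA, B * M, mul_pos hB hM, fun f hf => ?_⟩
  have hfg : DifferentiableOn ℂ (fun z => f z * deriv g z) (ball (0:ℂ) 1) :=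
    hf.mul (hg.deriv isOpen_ball)
  have hVg : Vg g f = Jop (fun z => f z * deriv g z) := rfl
  have hderiv : ∀ z ∈ ball (0:ℂ) 1, HasDerivAt (Vg g f) (f z * deriv g z) z := fun z hz =>
    hVg ▸ hasDerivAt_Jop hfg hz
  have hlower : ENNReal.ofReal (m / A) * wSup (fun r => (1 - r) * v r) f ≤ wSup v (Vg g f) := by
    rcases eq_top_or_lt_top (wSup v (Vg g f)) with htop | hlt
    · rw [htop]; exact le_top
    have hbound : wSup (fun r => (1 - r) * v r) f ≤
        ENNReal.ofReal m⁻¹ * wSup (fun r => (1 - r) * v r) (deriv (Vg g f)) := by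
      refine wSup_le_mul_wSup hw (inv_nonneg.2 hm.le) fun z hz => ?_
      rw [(hderiv z hz).deriv, norm_mul, le_inv_mul_iff₀ hm, mul_comm]
      exact mul_le_mul_of_nonneg_left (hg' z hz).1 (norm_nonneg _)
    have hDV := hD (Vg g f)
      (fun z hz => (hderiv z hz).differentiableAt.differentiableWithinAt) hlt
    calc ENNReal.ofReal (m / A) * wSup (fun r => (1 - r) * v r) f
        ≤ ENNReal.ofReal (m / A) *
            (ENNReal.ofReal m⁻¹ * (ENNReal.ofReal A * wSup v (Vg g f))) := by
          gcongr
          exact hbound.trans (by gcongr)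
      _ = ENNReal.ofReal (m / A * (m⁻¹ * A)) * wSup v (Vg g f) := by
          rw [ENNReal.ofReal_mul (div_pos hm hA).le, ENNReal.ofReal_mul (inv_nonneg.2 hm.le)]
          simp only [mul_assoc]
      _ = wSup v (Vg g f) := by
          have hone : m / A * (m⁻¹ * A) = 1 := by field_simp
          rw [hone, ENNReal.ofReal_one, one_mul]
  have hupper : wSup v (Vg g f) ≤
      ENNReal.ofReal (B * M) * wSup (fun r => (1 - r) * v r) f := by
    rcases eq_top_or_lt_top (wSup (fun r => (1 - r) * v r) f) with htop | hlt
    · rw [htop, ENNReal.mul_top (ENNReal.ofReal_pos.2 (mul_pos hB hM)).ne']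
      exact le_top
    have hbound : wSup (fun r => (1 - r) * v r) (fun z => f z * deriv g z) ≤
        ENNReal.ofReal M * wSup (fun r => (1 - r) * v r) f := by
      refine wSup_le_mul_wSup hw hM.le fun z hz => ?_
      rw [norm_mul, mul_comm]
      exact mul_le_mul_of_nonneg_right (hg' z hz).2 (norm_nonneg _)
    have hJf := hJ _ hfg (hbound.trans_lt (ENNReal.mul_lt_top ENNReal.ofReal_lt_top hlt))
    rw [ENNReal.ofReal_mul hB.le, mul_assoc, hVg]
    exact hJf.trans (by gcongr)
  refine ⟨⟨hlower, hupper⟩, fun hlt => ?_, fun hlt =>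
    hupper.trans_lt (ENNReal.mul_lt_top ENNReal.ofReal_lt_top hlt)⟩
  exact ENNReal.lt_top_of_mul_ne_top_right (hlower.trans_lt hlt).ne
    (ENNReal.ofReal_pos.2 (div_pos hm hA)).ne'
end

section
/- Let γ > 0 and let g be analytic on 𝔻 with constants 0 < m ≤ |g'(z)| ≤ M for all z ∈ 𝔻. Then there exist c₁, c₂ > 0 such that for every analytic f on 𝔻 (suprema in [0,∞]): c₁·sup_{z∈𝔻}(1−|z|)^{γ+1}|f(z)| ≤ sup_{z∈𝔻}(1−|z|)^{γ}|(V_g f)(z)| ≤ c₂·sup_{z∈𝔻}(1−|z|)^{γ+1}|f(z)|. In particular, sup_{z∈𝔻}(1−|z|)^{γ}|(V_g f)(z)| < ∞ if and only if sup_{z∈𝔻}(1−|z|)^{γ+1}|f(z)| < ∞; that is, the optimal domain [V_g, A^{−γ}] equals the Korenblum space A^{−(γ+1)} with equivalent norms. -/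
open Metric ENNReal

/-- The Korenblum sup-"norm" `sup_{z ∈ 𝔻} (1-|z|)^β·|f(z)|`, computed in `[0,∞]`. -/
noncomputable def korSup (β : ℝ) (f : ℂ → ℂ) : ℝ≥0∞ :=
  ⨆ z ∈ ball (0:ℂ) 1, ENNReal.ofReal ((1 - ‖z‖) ^ β * ‖f z‖)

lemma korSup_le_ofReal_iff {β K : ℝ} (hK : 0 ≤ K) (f : ℂ → ℂ) :
    korSup β f ≤ ENNReal.ofReal K ↔ ∀ z ∈ ball (0:ℂ) 1, (1 - ‖z‖) ^ β * ‖f z‖ ≤ K := by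
  simp only [korSup, iSup_le_iff, ENNReal.ofReal_le_ofReal_iff hK]

/-- To compare two Korenblum suprema it suffices to transfer every finite bound. -/
lemma korSup_le_mul_korSup {α β C : ℝ} (hC : 0 < C) {f F : ℂ → ℂ}
    (h : ∀ K, 0 ≤ K → (∀ z ∈ ball (0:ℂ) 1, (1 - ‖z‖) ^ α * ‖f z‖ ≤ K) →
      ∀ z ∈ ball (0:ℂ) 1, (1 - ‖z‖) ^ β * ‖F z‖ ≤ C * K) :
    korSup β F ≤ ENNReal.ofReal C * korSup α f := by
  rcases eq_or_ne (korSup α f) ⊤ with htop | htop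
  · simp [htop, ENNReal.mul_top, hC]
  · have hK : 0 ≤ (korSup α f).toReal := ENNReal.toReal_nonneg
    rw [← ENNReal.ofReal_toReal htop, ← ENNReal.ofReal_mul hC.le,
      korSup_le_ofReal_iff (mul_nonneg hC.le hK)]
    refine h _ hK ((korSup_le_ofReal_iff hK f).1 ?_)
    rw [ENNReal.ofReal_toReal htop]

lemma ofReal_mul_mem_unit_ball {z : ℂ} (hz : z ∈ ball (0:ℂ) 1) {s : ℝ} (hs : s ∈ Set.Icc (0:ℝ) 1) :
    (s : ℂ) * z ∈ ball (0:ℂ) 1 := by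
  rw [mem_ball_zero_iff] at hz ⊢
  rw [norm_mul, Complex.norm_real, Real.norm_of_nonneg hs.1]
  exact (mul_le_of_le_one_left (norm_nonneg z) hs.2).trans_lt hz

lemma hasDerivAt_comp_ofReal_mul {F h : ℂ → ℂ}
    (hF : ∀ z ∈ ball (0:ℂ) 1, HasDerivAt F (h z) z) {z : ℂ} (hz : z ∈ ball (0:ℂ) 1)
    {s : ℝ} (hs : s ∈ Set.Icc (0:ℝ) 1) :
    HasDerivAt (fun t : ℝ => F ((t : ℂ) * z)) (h ((s : ℂ) * z) * z) s := by
  have hmul : HasDerivAt (fun w : ℂ => w * z) z (s : ℂ) := by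
    simpa using (hasDerivAt_id (s : ℂ)).mul_const z
  exact ((hF _ (ofReal_mul_mem_unit_ball hz hs)).comp (s : ℂ) hmul).comp_ofReal

/-- On the disc, `Vg g f` is the primitive of `f * deriv g` vanishing at the origin. -/
lemma Vg_eq_of_hasDerivAt {g f F : ℂ → ℂ}
    (hcont : ContinuousOn (fun z => f z * deriv g z) (ball (0:ℂ) 1)) (hF0 : F 0 = 0)
    (hF : ∀ z ∈ ball (0:ℂ) 1, HasDerivAt F (f z * deriv g z) z) {z : ℂ}
    (hz : z ∈ ball (0:ℂ) 1) : Vg g f z = F z := by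
  have hcomp : ContinuousOn
      (fun s : ℝ => f ((s : ℂ) * z) * deriv g ((s : ℂ) * z) * z) (Set.uIcc 0 1) := by
    rw [Set.uIcc_of_le zero_le_one]
    refine ContinuousOn.mul ?_ continuousOn_const
    exact hcont.comp (f := fun s : ℝ => (s : ℂ) * z) (by fun_prop)
      fun s hs => ofReal_mul_mem_unit_ball hz hs
  have hint := intervalIntegral.integral_eq_sub_of_hasDerivAt
    (fun s hs => hasDerivAt_comp_ofReal_mul hF hz
      (by rwa [Set.uIcc_of_le zero_le_one] at hs)) hcomp.intervalIntegrable
  rw [intervalIntegral.integral_mul_const] at hint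
  simpa [Vg, mul_comm, hF0] using hint

/-- A growth bound of order `γ + 1` on the derivative integrates to one of order `γ`. -/
lemma growth_bound_of_deriv {γ K : ℝ} (hγ : 0 < γ) (hK : 0 ≤ K) {F h : ℂ → ℂ} (hF0 : F 0 = 0)
    (hF : ∀ z ∈ ball (0:ℂ) 1, HasDerivAt F (h z) z)
    (hh : ∀ z ∈ ball (0:ℂ) 1, (1 - ‖z‖) ^ (γ + 1) * ‖h z‖ ≤ K) {z : ℂ}
    (hz : z ∈ ball (0:ℂ) 1) : (1 - ‖z‖) ^ γ * ‖F z‖ ≤ K / γ := by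
  have hz1 : ‖z‖ < 1 := mem_ball_zero_iff.1 hz
  have hpos : ∀ s ∈ Set.Icc (0:ℝ) 1, 0 < 1 - s * ‖z‖ := fun s hs => by
    nlinarith [mul_le_of_le_one_left (norm_nonneg z) hs.2]
  have hB : ∀ s ∈ Set.Icc (0:ℝ) 1,
      HasDerivAt (fun t : ℝ => K / γ * (1 - t * ‖z‖) ^ (-γ))
        (K * (1 - s * ‖z‖) ^ (-(γ + 1)) * ‖z‖) s := fun s hs => by
    have hlin : HasDerivAt (fun t : ℝ => 1 - t * ‖z‖) (-‖z‖) s := by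
      simpa using ((hasDerivAt_id s).mul_const ‖z‖).const_sub 1
    refine ((hlin.rpow_const (p := -γ) (Or.inl (hpos s hs).ne')).const_mul (K / γ)).congr_deriv ?_
    rw [show -γ - 1 = -(γ + 1) by ring]
    field_simp
  have key := image_norm_le_of_norm_deriv_right_le_deriv_boundary' (a := (0:ℝ)) (b := 1)
    (HasDerivAt.continuousOn fun s hs => hasDerivAt_comp_ofReal_mul hF hz hs)
    (fun s hs => (hasDerivAt_comp_ofReal_mul hF hz (Set.Ico_subset_Icc_self hs)).hasDerivWithinAt)
    (by simpa [hF0] using div_nonneg hK hγ.le)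
    (HasDerivAt.continuousOn hB)
    (fun s hs => (hB s (Set.Ico_subset_Icc_self hs)).hasDerivWithinAt)
    (fun s hs => ?_) (Set.right_mem_Icc.2 zero_le_one)
  · have hzpos : 0 < 1 - ‖z‖ := sub_pos.2 hz1
    simp only [Complex.ofReal_one, one_mul] at key
    rw [Real.rpow_neg hzpos.le, ← div_eq_mul_inv, le_div_iff₀ (by positivity)] at key
    linarith
  · have hs' := Set.Ico_subset_Icc_self hs
    have hsp := hpos s hs'
    have hb := hh _ (ofReal_mul_mem_unit_ball hz hs')
    rw [norm_mul, Complex.norm_real, Real.norm_of_nonneg hs.1] at hb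
    rw [norm_mul, Real.rpow_neg hsp.le, ← div_eq_mul_inv]
    gcongr
    rw [le_div_iff₀ (by positivity)]
    linarith

/-- Cauchy's estimate: a growth bound of order `γ` yields one of order `γ + 1` on the derivative. -/
lemma deriv_growth_bound {γ K : ℝ} (hγ : 0 < γ) {F h : ℂ → ℂ}
    (hF : ∀ z ∈ ball (0:ℂ) 1, HasDerivAt F (h z) z)
    (hb : ∀ z ∈ ball (0:ℂ) 1, (1 - ‖z‖) ^ γ * ‖F z‖ ≤ K) {z : ℂ}
    (hz : z ∈ ball (0:ℂ) 1) : (1 - ‖z‖) ^ (γ + 1) * ‖h z‖ ≤ 2 ^ (γ + 1) * K := by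
  have hz1 : ‖z‖ < 1 := mem_ball_zero_iff.1 hz
  obtain ⟨r, hr⟩ : ∃ r, 1 - ‖z‖ = 2 * r := ⟨(1 - ‖z‖) / 2, by ring⟩
  have hrpos : 0 < r := by linarith
  have hnorm : ∀ w ∈ closedBall z r, r ≤ 1 - ‖w‖ := fun w hw => by
    have := norm_le_norm_add_norm_sub' w z
    rw [mem_closedBall, dist_eq_norm] at hw
    linarith
  have hsub : closedBall z r ⊆ ball (0:ℂ) 1 := fun w hw => by
    rw [mem_ball_zero_iff]
    linarith [hnorm w hw]
  have hdiff : DiffContOnCl ℂ F (ball z r) := by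
    refine DifferentiableOn.diffContOnCl fun w hw => ?_
    rw [closure_ball z hrpos.ne'] at hw
    exact (hF w (hsub hw)).differentiableAt.differentiableWithinAt
  have hC := Complex.norm_deriv_le_of_forall_mem_sphere_norm_le (C := K / r ^ γ) hrpos hdiff
    fun w hw => by
      have hw' := sphere_subset_closedBall hw
      rw [le_div_iff₀ (by positivity), mul_comm]
      refine le_trans ?_ (hb w (hsub hw'))
      gcongr
      exact hnorm w hw'
  rw [(hF z hz).deriv, div_div, ← Real.rpow_add_one hrpos.ne', le_div_iff₀ (by positivity)] at hC
  rw [hr, Real.mul_rpow zero_le_two hrpos.le, mul_assoc]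
  gcongr
  linarith

/-- For `γ > 0` and `g` analytic on `𝔻` with `0 < m ≤ |g'| ≤ M`, there are
`c₁, c₂ > 0` such that `c₁·‖f‖_{A^{-(γ+1)}} ≤ ‖V_g f‖_{A^{-γ}} ≤ c₂·‖f‖_{A^{-(γ+1)}}` for all
analytic `f`; in particular the optimal domain `[V_g, A^{-γ}]` equals `A^{-(γ+1)}` with
equivalent norms. -/
theorem optimalDomain_Vg_Korenblum
    (γ : ℝ) (hγ : 0 < γ)
    (g : ℂ → ℂ) (hg : DifferentiableOn ℂ g (ball (0:ℂ) 1))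
    (m M : ℝ) (hm : 0 < m)
    (hg' : ∀ z ∈ ball (0:ℂ) 1, m ≤ ‖deriv g z‖ ∧ ‖deriv g z‖ ≤ M) :
    ∃ c₁ > (0:ℝ), ∃ c₂ > (0:ℝ), ∀ f : ℂ → ℂ, DifferentiableOn ℂ f (ball (0:ℂ) 1) →
      (ENNReal.ofReal c₁ * korSup (γ + 1) f ≤ korSup γ (Vg g f) ∧
        korSup γ (Vg g f) ≤ ENNReal.ofReal c₂ * korSup (γ + 1) f) ∧
      (korSup γ (Vg g f) < ⊤ ↔ korSup (γ + 1) f < ⊤) := by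
  have hM : 0 < M := by
    obtain ⟨h₁, h₂⟩ := hg' 0 (mem_ball_self one_pos)
    linarith
  have hC : 0 < (2:ℝ) ^ (γ + 1) / m := by positivity
  have hc₂ : 0 < M / γ := by positivity
  refine ⟨((2:ℝ) ^ (γ + 1) / m)⁻¹, inv_pos.2 hC, M / γ, hc₂, fun f hf => ?_⟩
  have hh : DifferentiableOn ℂ (fun z => f z * deriv g z) (ball (0:ℂ) 1) :=
    hf.mul (hg.deriv isOpen_ball)
  obtain ⟨F, hF0, hF⟩ := hh.isExactOn_ball.with_val_at 0 0
  have hVF : ∀ z ∈ ball (0:ℂ) 1, Vg g f z = F z := fun z hz =>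
    Vg_eq_of_hasDerivAt hh.continuousOn hF0 hF hz
  have hupper : korSup γ (Vg g f) ≤ ENNReal.ofReal (M / γ) * korSup (γ + 1) f := by
    refine korSup_le_mul_korSup hc₂ fun K hK hfK z hz => ?_
    rw [hVF z hz, div_mul_eq_mul_div]
    refine growth_bound_of_deriv hγ (mul_nonneg hM.le hK) hF0 hF (fun w hw => ?_) hz
    rw [norm_mul, ← mul_assoc, mul_comm M K]
    exact mul_le_mul (hfK w hw) (hg' w hw).2 (norm_nonneg _) hK
  have hlower : korSup (γ + 1) f ≤
      ENNReal.ofReal ((2:ℝ) ^ (γ + 1) / m) * korSup γ (Vg g f) := by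
    refine korSup_le_mul_korSup hC fun K hK hVK z hz => ?_
    have hz1 : 0 ≤ 1 - ‖z‖ := sub_nonneg.2 (mem_ball_zero_iff.1 hz).le
    have hb := deriv_growth_bound hγ hF (fun w hw => hVF w hw ▸ hVK w hw) hz
    rw [norm_mul, ← mul_assoc] at hb
    rw [div_mul_eq_mul_div, le_div_iff₀ hm]
    refine le_trans ?_ hb
    gcongr
    exact (hg' z hz).1
  refine ⟨⟨?_, hupper⟩, fun h => hlower.trans_lt (ENNReal.mul_lt_top ENNReal.ofReal_lt_top h),
    fun h => hupper.trans_lt (ENNReal.mul_lt_top ENNReal.ofReal_lt_top h)⟩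
  calc ENNReal.ofReal ((2:ℝ) ^ (γ + 1) / m)⁻¹ * korSup (γ + 1) f
      ≤ ENNReal.ofReal ((2:ℝ) ^ (γ + 1) / m)⁻¹ *
          (ENNReal.ofReal ((2:ℝ) ^ (γ + 1) / m) * korSup γ (Vg g f)) := by gcongr
    _ = korSup γ (Vg g f) := by
      rw [← mul_assoc, ← ENNReal.ofReal_mul (inv_pos.2 hC).le, inv_mul_cancel₀ hC.ne',
        ENNReal.ofReal_one, one_mul]
end

section
/- Let γ > 0 and let g be analytic on 𝔻 with constants 0 < m ≤ |g'(z)| ≤ M for all z ∈ 𝔻. Then A^{−γ} is a proper subset of the optimal domain [V_g, A_0^{−γ}]: (a) every analytic f on 𝔻 with sup_{z∈𝔻}(1−|z|)^{γ}|f(z)| < ∞ satisfies (1−|z|)^{γ}|(V_g f)(z)| → 0 as |z| → 1⁻; and (b) there exists an analytic f on 𝔻 with (1−|z|)^{γ}|(V_g f)(z)| → 0 as |z| → 1⁻ but sup_{z∈𝔻}(1−|z|)^{γ}|f(z)| = ∞. -/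
open Metric

/-- `(1-|z|)^β·|f(z)| → 0` as `|z| → 1⁻`. -/
def vanishesAtBoundary (β : ℝ) (f : ℂ → ℂ) : Prop :=
  ∀ ε > (0:ℝ), ∃ r < (1:ℝ), ∀ z ∈ ball (0:ℂ) 1,
    r < ‖z‖ → (1 - ‖z‖) ^ β * ‖f z‖ < ε

theorem vanishesAtBoundary_of_le_radial {β : ℝ} {f : ℂ → ℂ} {h : ℝ → ℝ}
    (hh : Filter.Tendsto h (nhdsWithin 1 (Set.Iio 1)) (nhds 0))
    (hf : ∀ z ∈ ball (0:ℂ) 1, (1 - ‖z‖) ^ β * ‖f z‖ ≤ h ‖z‖) :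
    vanishesAtBoundary β f := by
  intro ε hε
  obtain ⟨r, hr, hr'⟩ := mem_nhdsLT_iff_exists_Ioo_subset.1 (hh.eventually (gt_mem_nhds hε))
  exact ⟨r, hr, fun z hz hrz => (hf z hz).trans_lt (hr' ⟨hrz, mem_ball_zero_iff.1 hz⟩)⟩

theorem ofReal_mul_mem_ball {z : ℂ} (hz : z ∈ ball (0:ℂ) 1) {s : ℝ} (hs₀ : 0 ≤ s)
    (hs₁ : s ≤ 1) : (s : ℂ) * z ∈ ball (0:ℂ) 1 := by
  rw [mem_ball_zero_iff] at hz ⊢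
  rw [norm_mul, Complex.norm_of_nonneg hs₀]
  nlinarith [norm_nonneg z]

theorem continuousOn_rpow_div_one_sub_mul {γ : ℝ} (hγ : 0 ≤ γ) {r : ℝ} (hr₀ : 0 ≤ r)
    (hr₁ : r < 1) :
    ContinuousOn (fun s : ℝ => ((1 - r) / (1 - s * r)) ^ γ) (Set.Icc 0 1) := by
  refine ContinuousOn.rpow_const (continuousOn_const.div (by fun_prop) ?_) fun s _ => Or.inr hγ
  intro s hs
  nlinarith [hs.1, hs.2]

theorem tendsto_integral_rpow_div_one_sub_mul {γ : ℝ} (hγ : 0 < γ) :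
    Filter.Tendsto (fun r : ℝ => ∫ s in (0:ℝ)..1, ((1 - r) / (1 - s * r)) ^ γ)
      (nhdsWithin 1 (Set.Iio 1)) (nhds 0) := by
  have hIoo : ∀ᶠ r : ℝ in nhdsWithin 1 (Set.Iio 1), r ∈ Set.Ioo (0:ℝ) 1 :=
    Ioo_mem_nhdsLT zero_lt_one
  have key := intervalIntegral.tendsto_integral_filter_of_dominated_convergence
    (μ := MeasureTheory.volume) (a := 0) (b := 1) (l := nhdsWithin (1:ℝ) (Set.Iio 1))
    (F := fun (r s : ℝ) => ((1 - r) / (1 - s * r)) ^ γ) (f := fun _ => 0) (fun _ => 1)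
    ?_ ?_ ?_ ?_
  · simpa using key
  · filter_upwards [hIoo] with r hr
    rw [Set.uIoc_of_le zero_le_one]
    exact ((continuousOn_rpow_div_one_sub_mul hγ.le hr.1.le hr.2).mono
      Set.Ioc_subset_Icc_self).aestronglyMeasurable measurableSet_Ioc
  · filter_upwards [hIoo] with r hr
    refine Filter.Eventually.of_forall fun s hs => ?_
    rw [Set.uIoc_of_le zero_le_one] at hs
    have hpos : 0 < 1 - s * r := by nlinarith [hr.1, hr.2, hs.1, hs.2]
    have hnn : 0 ≤ (1 - r) / (1 - s * r) := div_nonneg (by linarith [hr.2]) hpos.le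
    rw [Real.norm_of_nonneg (Real.rpow_nonneg hnn _)]
    exact Real.rpow_le_one hnn ((div_le_one hpos).2 (by nlinarith [hr.1, hs.2])) hγ.le
  · exact intervalIntegrable_const
  · filter_upwards [MeasureTheory.Measure.ae_ne MeasureTheory.volume (1:ℝ)] with s hs _
    have hcont : ContinuousAt (fun r : ℝ => ((1 - r) / (1 - s * r)) ^ γ) 1 := by
      refine ContinuousAt.rpow_const (ContinuousAt.div (by fun_prop) (by fun_prop) ?_)
        (Or.inr hγ.le)
      rw [mul_one]
      exact sub_ne_zero.2 hs.symm
    simpa [Real.zero_rpow hγ.ne'] using hcont.tendsto.mono_left nhdsWithin_le_nhds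

theorem vanishesAtBoundary_Vg_of_bounded {γ : ℝ} (hγ : 0 < γ) {g f : ℂ → ℂ} {M C : ℝ}
    (hg' : ∀ z ∈ ball (0:ℂ) 1, ‖deriv g z‖ ≤ M)
    (hC : ∀ z ∈ ball (0:ℂ) 1, (1 - ‖z‖) ^ γ * ‖f z‖ ≤ C) :
    vanishesAtBoundary γ (Vg g f) := by
  have hlim := (tendsto_integral_rpow_div_one_sub_mul hγ).const_mul (C * M)
  rw [mul_zero] at hlim
  refine vanishesAtBoundary_of_le_radial hlim fun z hz => ?_
  have hz1 : ‖z‖ < 1 := mem_ball_zero_iff.1 hz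
  have hM : 0 ≤ M := (norm_nonneg _).trans (hg' z hz)
  have hw : 0 ≤ (1 - ‖z‖) ^ γ := Real.rpow_nonneg (by linarith) _
  have hint : ‖∫ s in (0:ℝ)..1,
      (((1 - ‖z‖) ^ γ : ℝ) : ℂ) * (f ((s : ℂ) * z) * deriv g ((s : ℂ) * z))‖ ≤
      ∫ s in (0:ℝ)..1, C * M * ((1 - ‖z‖) / (1 - s * ‖z‖)) ^ γ := by
    refine intervalIntegral.norm_integral_le_of_norm_le zero_le_one
      (Filter.Eventually.of_forall fun s hs => ?_) ?_
    · have hsz := ofReal_mul_mem_ball hz hs.1.le hs.2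
      have hfs := hC _ hsz
      have hgs := hg' _ hsz
      rw [norm_mul, Complex.norm_of_nonneg hs.1.le] at hfs
      have hpos : 0 < 1 - s * ‖z‖ := by nlinarith [norm_nonneg z, hs.1, hs.2]
      have hpow : 0 < (1 - s * ‖z‖) ^ γ := Real.rpow_pos_of_pos hpos _
      rw [norm_mul, norm_mul, Complex.norm_of_nonneg hw,
        Real.div_rpow (by linarith) hpos.le]
      calc (1 - ‖z‖) ^ γ * (‖f (s * z)‖ * ‖deriv g (s * z)‖)
          = ((1 - s * ‖z‖) ^ γ * ‖f (s * z)‖) * ‖deriv g (s * z)‖ *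
              ((1 - ‖z‖) ^ γ / (1 - s * ‖z‖) ^ γ) := by
            rw [mul_div_assoc', eq_div_iff hpow.ne']
            ring
        _ ≤ C * M * ((1 - ‖z‖) ^ γ / (1 - s * ‖z‖) ^ γ) := by
            have hC₀ : 0 ≤ C := (by positivity : (0:ℝ) ≤ _).trans hfs
            gcongr
    · refine (ContinuousOn.intervalIntegrable ?_).const_mul _
      rw [Set.uIcc_of_le zero_le_one]
      exact continuousOn_rpow_div_one_sub_mul hγ.le (norm_nonneg z) hz1
  rw [intervalIntegral.integral_const_mul, intervalIntegral.integral_const_mul, norm_mul,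
    Complex.norm_of_nonneg hw] at hint
  refine le_trans ?_ hint
  rw [Vg, norm_mul]
  gcongr
  exact mul_le_of_le_one_left (norm_nonneg _) hz1.le

theorem one_sub_mem_slitPlane {z : ℂ} (hz : z ∈ ball (0:ℂ) 1) : 1 - z ∈ Complex.slitPlane := by
  refine Or.inl ?_
  have := Complex.re_le_norm z
  have := mem_ball_zero_iff.1 hz
  simp only [Complex.sub_re, Complex.one_re]
  linarith

theorem hasDerivAt_one_sub_cpow (δ : ℂ) {z : ℂ} (hz : z ∈ ball (0:ℂ) 1) :
    HasDerivAt (fun w : ℂ => (1 - w) ^ (-δ)) (δ * (1 - z) ^ (-δ - 1)) z := by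
  convert ((hasDerivAt_id' z).const_sub 1).cpow_const (c := -δ) (one_sub_mem_slitPlane hz) using 1
  ring

theorem Vg_eq_sub {g f F : ℂ → ℂ}
    (hfg : ContinuousOn (fun w => f w * deriv g w) (ball (0:ℂ) 1))
    (hF : ∀ z ∈ ball (0:ℂ) 1, HasDerivAt F (f z * deriv g z) z) {z : ℂ}
    (hz : z ∈ ball (0:ℂ) 1) : Vg g f z = F z - F 0 := by
  have hmaps : Set.MapsTo (fun s : ℝ => (s : ℂ) * z) (Set.uIcc 0 1) (ball (0:ℂ) 1) := by
    intro s hs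
    rw [Set.uIcc_of_le zero_le_one] at hs
    exact ofReal_mul_mem_ball hz hs.1 hs.2
  rw [Vg, ← intervalIntegral.integral_const_mul,
    intervalIntegral.integral_eq_sub_of_hasDerivAt (f := fun s : ℝ => F (s * z))]
  · simp
  · intro s hs
    have hline : HasDerivAt (fun s : ℝ => (s : ℂ) * z) z s := by
      simpa using (Complex.ofRealCLM.hasDerivAt (x := s)).mul_const z
    rw [mul_comm z]
    exact (hF _ (hmaps hs)).comp s hline
  · exact (continuousOn_const.mul
      (hfg.comp (by fun_prop : Continuous fun s : ℝ => (s : ℂ) * z).continuousOn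
        hmaps)).intervalIntegrable

theorem norm_one_sub_cpow_le {δ : ℝ} (hδ : 0 ≤ δ) {z : ℂ} (hz : z ∈ ball (0:ℂ) 1) :
    ‖(1 - z) ^ (-(δ : ℂ))‖ ≤ (1 - ‖z‖) ^ (-δ) := by
  have hz1 := mem_ball_zero_iff.1 hz
  have h1 : 1 - ‖z‖ ≤ ‖1 - z‖ := by simpa using norm_sub_norm_le (1:ℂ) z
  rw [← Complex.ofReal_neg, Complex.norm_cpow_real]
  exact Real.rpow_le_rpow_of_nonpos (by linarith) h1 (by linarith)

theorem vanishesAtBoundary_one_sub_cpow {γ δ : ℝ} (hδ : 0 ≤ δ) (hδγ : δ < γ) {f : ℂ → ℂ}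
    (hf : ∀ z ∈ ball (0:ℂ) 1, f z = (1 - z) ^ (-(δ : ℂ)) - 1) :
    vanishesAtBoundary γ f := by
  have hlim : Filter.Tendsto (fun r : ℝ => 2 * (1 - r) ^ (γ - δ))
      (nhdsWithin 1 (Set.Iio 1)) (nhds 0) := by
    have hcont : ContinuousAt (fun r : ℝ => 2 * (1 - r) ^ (γ - δ)) 1 :=
      continuousAt_const.mul (ContinuousAt.rpow_const (by fun_prop) (Or.inr (by linarith)))
    simpa [Real.zero_rpow (sub_pos.2 hδγ).ne'] using hcont.tendsto.mono_left nhdsWithin_le_nhds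
  refine vanishesAtBoundary_of_le_radial hlim fun z hz => ?_
  have hz1 : 0 < 1 - ‖z‖ := sub_pos.2 (mem_ball_zero_iff.1 hz)
  have hone : 1 ≤ (1 - ‖z‖) ^ (-δ) :=
    Real.one_le_rpow_of_pos_of_le_one_of_nonpos hz1 (by linarith [norm_nonneg z]) (by linarith)
  calc (1 - ‖z‖) ^ γ * ‖f z‖
      ≤ (1 - ‖z‖) ^ γ * (2 * (1 - ‖z‖) ^ (-δ)) := by
        gcongr
        rw [hf z hz]
        refine (norm_sub_le _ _).trans ?_
        rw [norm_one]
        linarith [norm_one_sub_cpow_le hδ hz]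
    _ = 2 * (1 - ‖z‖) ^ (γ - δ) := by
        rw [sub_eq_add_neg γ δ, Real.rpow_add hz1]
        ring

theorem not_bounded_one_sub_cpow_div {γ δ : ℝ} (hδ : 0 < δ) (hγδ : γ < δ + 1) {h : ℂ → ℂ}
    {m M : ℝ} (hm : 0 < m) (hh : ∀ z ∈ ball (0:ℂ) 1, m ≤ ‖h z‖ ∧ ‖h z‖ ≤ M) :
    ¬ ∃ C : ℝ, ∀ z ∈ ball (0:ℂ) 1,
      (1 - ‖z‖) ^ γ * ‖(δ : ℂ) * (1 - z) ^ (-(δ : ℂ) - 1) / h z‖ ≤ C := by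
  rintro ⟨C, hC⟩
  have hlim : Filter.Tendsto (fun x : ℝ => x ^ (γ - δ - 1)) (nhdsWithin 0 (Set.Ioi 0))
      Filter.atTop := tendsto_rpow_neg_nhdsGT_zero (by linarith)
  obtain ⟨x, hx, hx0, hx1⟩ := ((hlim.eventually_gt_atTop (C * M / δ)).and
    (Ioo_mem_nhdsGT (zero_lt_one' ℝ))).exists
  have hnorm : ‖((1 - x : ℝ) : ℂ)‖ = 1 - x := Complex.norm_of_nonneg (by linarith)
  have hmem : ((1 - x : ℝ) : ℂ) ∈ ball (0:ℂ) 1 := by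
    rw [mem_ball_zero_iff, hnorm]
    linarith
  obtain ⟨hlow, hup⟩ := hh _ hmem
  have hhpos : 0 < ‖h ((1 - x : ℝ) : ℂ)‖ := hm.trans_le hlow
  have hbound := hC _ hmem
  have hpow : ‖(1 - ((1 - x : ℝ) : ℂ)) ^ (-(δ : ℂ) - 1)‖ = x ^ (-δ - 1) := by
    have hbase : (1 : ℂ) - ((1 - x : ℝ) : ℂ) = (x : ℂ) := by push_cast; ring
    rw [hbase, Complex.norm_cpow_eq_rpow_re_of_pos hx0]
    simp
  rw [norm_div, norm_mul, hpow, hnorm, sub_sub_cancel, Complex.norm_of_nonneg hδ.le,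
    ← mul_div_assoc, div_le_iff₀ hhpos] at hbound
  have hC₀ : 0 ≤ C := by
    have : 0 < C * ‖h ((1 - x : ℝ) : ℂ)‖ := lt_of_lt_of_le (by positivity) hbound
    exact (pos_of_mul_pos_left this hhpos.le).le
  have hCM : C * ‖h ((1 - x : ℝ) : ℂ)‖ ≤ C * M := by gcongr
  rw [div_lt_iff₀ hδ] at hx
  have hsplit : x ^ (γ - δ - 1) = x ^ γ * x ^ (-δ - 1) := by
    rw [← Real.rpow_add hx0]
    ring_nf
  rw [hsplit] at hx
  linarith

/-- For `γ > 0` and `g` analytic on `𝔻` with `0 < m ≤ |g'| ≤ M`, the space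
`A^{-γ}` is a proper subset of the optimal domain `[V_g, A₀^{-γ}]`: (a) every analytic `f`
with `sup (1-|z|)^γ|f(z)| < ∞` satisfies `(1-|z|)^γ|(V_g f)(z)| → 0` as `|z| → 1⁻`, and
(b) some analytic `f` satisfies `(1-|z|)^γ|(V_g f)(z)| → 0` while `(1-|z|)^γ|f(z)|` is
unbounded on `𝔻`. -/
theorem Korenblum_properSubset_optimalDomain_little
    (γ : ℝ) (hγ : 0 < γ)
    (g : ℂ → ℂ) (hg : DifferentiableOn ℂ g (ball (0:ℂ) 1))
    (m M : ℝ) (hm : 0 < m)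
    (hg' : ∀ z ∈ ball (0:ℂ) 1, m ≤ ‖deriv g z‖ ∧ ‖deriv g z‖ ≤ M) :
    (∀ f : ℂ → ℂ, DifferentiableOn ℂ f (ball (0:ℂ) 1) →
      (∃ C : ℝ, ∀ z ∈ ball (0:ℂ) 1, (1 - ‖z‖) ^ γ * ‖f z‖ ≤ C) →
      vanishesAtBoundary γ (Vg g f)) ∧
    (∃ f : ℂ → ℂ, DifferentiableOn ℂ f (ball (0:ℂ) 1) ∧
      vanishesAtBoundary γ (Vg g f) ∧
      ¬ ∃ C : ℝ, ∀ z ∈ ball (0:ℂ) 1, (1 - ‖z‖) ^ γ * ‖f z‖ ≤ C) := by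
  refine ⟨fun f _ ⟨C, hC⟩ =>
    vanishesAtBoundary_Vg_of_bounded hγ (fun z hz => (hg' z hz).2) hC, ?_⟩
  obtain ⟨δ, hδ, hδγ⟩ : ∃ δ : ℝ, max 0 (γ - 1) < δ ∧ δ < γ :=
    exists_between (max_lt hγ (by linarith))
  obtain ⟨hδ₀, hδ₁⟩ := max_lt_iff.1 hδ
  have hne : ∀ z ∈ ball (0:ℂ) 1, deriv g z ≠ 0 := fun z hz =>
    norm_pos_iff.1 (hm.trans_le (hg' z hz).1)
  have hnum : DifferentiableOn ℂ (fun z : ℂ => (δ : ℂ) * (1 - z) ^ (-(δ : ℂ) - 1))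
      (ball (0:ℂ) 1) := fun z hz =>
    (((differentiableAt_const 1).sub differentiableAt_id).cpow_const
      (one_sub_mem_slitPlane hz)).const_mul _ |>.differentiableWithinAt
  have hcancel : ∀ z ∈ ball (0:ℂ) 1,
      (δ : ℂ) * (1 - z) ^ (-(δ : ℂ) - 1) / deriv g z * deriv g z =
        (δ : ℂ) * (1 - z) ^ (-(δ : ℂ) - 1) := fun z hz => div_mul_cancel₀ _ (hne z hz)
  refine ⟨fun z => (δ : ℂ) * (1 - z) ^ (-(δ : ℂ) - 1) / deriv g z,
    hnum.div (hg.deriv isOpen_ball) hne, ?_, not_bounded_one_sub_cpow_div hδ₀ (by linarith) hm hg'⟩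
  refine vanishesAtBoundary_one_sub_cpow hδ₀.le hδγ fun z hz => ?_
  rw [Vg_eq_sub (F := fun w : ℂ => (1 - w) ^ (-(δ : ℂ))) (hnum.continuousOn.congr hcancel) ?_ hz]
  · simp
  · intro w hw
    rw [hcancel w hw]
    exact hasDerivAt_one_sub_cpow _ hw
end

section
/- Let g be analytic on 𝔻 with constants 0 < m ≤ |g'(z)| ≤ M for all z ∈ 𝔻. Then: (a) for every analytic f on 𝔻 with sup_{0≤r<1} ∫₀^{2π} |f(re^{iθ})| dθ < ∞ (i.e. f ∈ H^1), the function V_g f extends to a continuous function on the closed unit disc; (b) for every analytic f on 𝔻, if V_g f extends to a continuous function on the closed unit disc then (1−|z|)|f(z)| → 0 as |z| → 1⁻. That is, H^1 ⊆ [V_g, A(𝔻)] ⊆ A_0^{−1}. -/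
open Metric Real

/-- `f` belongs to the Hardy space `H¹`: `sup_{0≤r<1} ∫₀^{2π} |f(r e^{iθ})| dθ < ∞`. -/
def memH1 (f : ℂ → ℂ) : Prop :=
  ∃ C : ℝ, ∀ r ∈ Set.Ico (0:ℝ) 1,
    (∫ θ in (0:ℝ)..(2 * π), ‖f ((r : ℂ) * Complex.exp ((θ : ℂ) * Complex.I))‖) ≤ C

/-- `h` extends to a continuous function on the closed unit disc (membership in the
disc algebra `A(𝔻)`). -/
def memDiscAlgebra (h : ℂ → ℂ) : Prop :=
  ∃ F : ℂ → ℂ, ContinuousOn F (closedBall (0:ℂ) 1) ∧ ∀ z ∈ ball (0:ℂ) 1, F z = h z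

/-- `(1-|z|)·|f(z)| → 0` as `|z| → 1⁻` (membership in `A₀^{-1}`). -/
def memA0minus1 (f : ℂ → ℂ) : Prop :=
  ∀ ε > (0:ℝ), ∃ r < (1:ℝ), ∀ z ∈ ball (0:ℂ) 1,
    r < ‖z‖ → (1 - ‖z‖) * ‖f z‖ < ε

open Polynomial in
/-- Every continuous real function on the unit circle is uniformly approximated by real parts of
complex polynomials. -/
theorem exists_polynomial_re_near_of_continuousOn_sphere {u : ℂ → ℝ}
    (hu : ContinuousOn u (sphere (0:ℂ) 1)) {ε : ℝ} (hε : 0 < ε) :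
    ∃ Q : ℂ[X], ∀ z ∈ sphere (0:ℂ) 1, |(Q.eval z).re - u z| < ε := by
  have : Fact (0 < 2 * π) := ⟨Real.two_pi_pos⟩
  let e : AddCircle (2 * π) ≃ₜ Circle := AddCircle.homeomorphCircle'
  have hmem : ∀ z : Circle, (z : ℂ) ∈ sphere (0:ℂ) 1 := fun z => by
    rw [mem_sphere_zero_iff_norm, Circle.norm_coe]
  let φ : C(AddCircle (2 * π), ℂ) :=
    ⟨fun t => (u (e t : ℂ) : ℂ), Complex.continuous_ofReal.comp
      (hu.comp_continuous (continuous_subtype_val.comp e.continuous) fun t => hmem _)⟩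
  have hφ : φ ∈ (Submodule.span ℂ (Set.range (@fourier (2 * π)))).topologicalClosure := by
    rw [span_fourier_closure_eq_top]; trivial
  obtain ⟨ψ, hψ, hd⟩ := Metric.mem_closure_iff.1 hφ ε hε
  have key : ∀ c : ℂ, ∃ Q : ℂ[X], ∀ t, (c * ψ t).re = (Q.eval (e t : ℂ)).re := by
    clear hd
    induction hψ using Submodule.span_induction with
    | mem x hx =>
      obtain ⟨n, rfl⟩ := hx
      intro c
      have he : ∀ t, (e t : ℂ) = fourier 1 t := by
        intro t
        induction t using QuotientAddGroup.induction_on with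
        | H t =>
          change ((AddCircle.homeomorphCircle' (t : AddCircle (2 * π)) : Circle) : ℂ) = _
          rw [AddCircle.homeomorphCircle'_apply_mk, fourier_one, AddCircle.toCircle_apply_mk]
          simp
      have hpow : ∀ (k : ℕ) t, (fourier (k : ℤ) t : ℂ) = (e t : ℂ) ^ k := by
        intro k t
        rw [he, fourier_apply, fourier_apply, natCast_zsmul, one_zsmul, AddCircle.toCircle_nsmul]
        simp
      obtain ⟨k, rfl | rfl⟩ := n.eq_nat_or_neg
      · exact ⟨Polynomial.monomial k c, fun t => by rw [hpow]; simp⟩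
      · refine ⟨Polynomial.monomial k (starRingEnd ℂ c), fun t => ?_⟩
        rw [fourier_neg, hpow, Polynomial.eval_monomial, ← Complex.conj_re, map_mul,
          Complex.conj_conj]
    | zero => exact fun c => ⟨0, fun t => by simp⟩
    | add x y _ _ hx hy =>
      intro c
      obtain ⟨Q, hQ⟩ := hx c
      obtain ⟨R, hR⟩ := hy c
      exact ⟨Q + R, fun t => by simp [mul_add, ← hQ, ← hR]⟩
    | smul a x _ hx =>
      intro c
      obtain ⟨Q, hQ⟩ := hx (c * a)
      exact ⟨Q, fun t => by simp [← hQ, mul_assoc]⟩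
  obtain ⟨Q, hQ⟩ := key 1
  refine ⟨Q, fun z hz => ?_⟩
  obtain ⟨t, ht⟩ := e.surjective ⟨z, by simpa [Submonoid.unitSphere] using hz⟩
  have hzt : (e t : ℂ) = z := by rw [ht]
  have h1 := (ContinuousMap.dist_apply_le_dist (f := φ) (g := ψ) t).trans_lt hd
  have h2 := hQ t
  rw [hzt, one_mul] at h2
  rw [← h2, abs_sub_comm]
  have h3 : u z - (ψ t).re = (φ t - ψ t).re := by
    simp [φ, hzt]
  rw [h3]
  exact (Complex.abs_re_le_norm _).trans_lt (by rwa [← dist_eq_norm])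

open Polynomial in
/-- An entire function is uniformly approximated on the closed unit disc by polynomials. -/
theorem exists_polynomial_near_of_differentiable {E : ℂ → ℂ} (hE : Differentiable ℂ E)
    {ε : ℝ} (hε : 0 < ε) :
    ∃ P : ℂ[X], ∀ z ∈ closedBall (0:ℂ) 1, ‖E z - P.eval z‖ < ε := by
  have hs := hE.hasFPowerSeriesOnBall 0 (R := 3) (by norm_num)
  have ht := Metric.tendstoUniformlyOn_iff.1
    (hs.tendstoUniformlyOn' (r' := 2) ENNReal.coe_lt_top) ε hε
  obtain ⟨n, hn⟩ := ht.exists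
  refine ⟨∑ k ∈ Finset.range n,
    Polynomial.monomial k ((cauchyPowerSeries E 0 3).coeff k), fun z hz => ?_⟩
  have hz2 : z ∈ ball (0:ℂ) (2 : NNReal) := closedBall_subset_ball (by norm_num) hz
  have h := hn z hz2
  rw [dist_eq_norm, sub_zero] at h
  rw [Polynomial.eval_finsetSum]
  simpa [FormalMultilinearSeries.partialSum, mul_comm] using h

open Polynomial in
/-- A function holomorphic on the disc and continuous up to the boundary is dominated by the squared
modulus of a polynomial whose `ℓ²` norm is controlled by the `H¹` norm of the function. -/
theorem exists_polynomial_sq_majorant {h : ℂ → ℂ} (hh : DiffContOnCl ℂ h (ball (0:ℂ) 1)) :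
    ∃ P : ℂ[X], (∀ z ∈ closedBall (0:ℂ) 1, ‖h z‖ ≤ 2 * ‖P.eval z‖ ^ 2 + 2) ∧
      ∑ i ∈ P.support, ‖P.coeff i‖ ^ 2 ≤ 8 * circleAverage (fun z => ‖h z‖) 0 1 + 10 := by
  have hc : ContinuousOn h (closedBall (0:ℂ) 1) := by
    simpa using hh.continuousOn_ball
  have hcs := hc.mono (sphere_subset_closedBall (x := (0:ℂ)) (ε := 1))
  have hu : ContinuousOn (fun z => log (2 * (‖h z‖ + 1))) (sphere (0:ℂ) 1) := by
    refine ContinuousOn.log (by fun_prop) fun z _ => by positivity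
  obtain ⟨Q, hQ⟩ := exists_polynomial_re_near_of_continuousOn_sphere hu (log_pos one_lt_two)
  have hlow : ∀ z ∈ sphere (0:ℂ) 1, ‖h z‖ + 1 ≤ exp (Q.eval z).re := by
    intro z hz
    have h1 := (abs_lt.1 (hQ z hz)).1
    rw [log_mul (by norm_num) (by positivity)] at h1
    rw [← log_le_iff_le_exp (by positivity)]
    linarith
  have hupp : ∀ z ∈ sphere (0:ℂ) 1, exp (Q.eval z).re ≤ 4 * (‖h z‖ + 1) := by
    intro z hz
    have h1 := (abs_lt.1 (hQ z hz)).2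
    rw [← le_log_iff_exp_le (by positivity),
      show (4:ℝ) * (‖h z‖ + 1) = 2 * (2 * (‖h z‖ + 1)) by ring,
      log_mul (by norm_num) (by positivity)]
    linarith
  have hQd : Differentiable ℂ fun z => Q.eval z := Q.differentiable
  have hEd : Differentiable ℂ fun z => Complex.exp (Q.eval z / 2) := by fun_prop
  have hnorm : ∀ z, ‖Complex.exp (Q.eval z / 2)‖ ^ 2 = exp (Q.eval z).re := by
    intro z
    rw [Complex.norm_exp, ← exp_nat_mul]
    congr 1
    simp
    ring
  obtain ⟨P, hP⟩ := exists_polynomial_near_of_differentiable hEd one_pos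
  have hdom : ∀ z ∈ closedBall (0:ℂ) 1, ‖h z‖ ≤ exp (Q.eval z).re := by
    intro z hz
    have hd : DiffContOnCl ℂ (fun z => Complex.exp (- Q.eval z) • h z) (ball (0:ℂ) 1) := by
      refine DiffContOnCl.smul (Differentiable.diffContOnCl ?_) hh
      fun_prop
    have hz' : z ∈ closure (ball (0:ℂ) 1) := by rwa [closure_ball _ one_ne_zero]
    have := Complex.norm_le_of_forall_mem_frontier_norm_le isBounded_ball hd (C := 1) ?_ hz'
    · rw [norm_smul, Complex.norm_exp, Complex.neg_re, Real.exp_neg,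
        inv_mul_le_iff₀ (exp_pos _), mul_one] at this
      exact this
    · intro w hw
      rw [frontier_ball _ one_ne_zero] at hw
      rw [norm_smul, Complex.norm_exp, Complex.neg_re, Real.exp_neg,
        inv_mul_le_iff₀ (exp_pos _), mul_one]
      linarith [hlow w hw]
  refine ⟨P, fun z hz => ?_, ?_⟩
  · have h1 := hP z hz
    have h2 : ‖Complex.exp (Q.eval z / 2)‖ ≤ ‖P.eval z‖ + 1 := by
      have := norm_le_norm_add_norm_sub (P.eval z) (Complex.exp (Q.eval z / 2))
      rw [norm_sub_rev] at this
      linarith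
    have h3 := hdom z hz
    rw [← hnorm] at h3
    nlinarith [norm_nonneg (Complex.exp (Q.eval z / 2)), norm_nonneg (P.eval z),
      sq_nonneg (‖P.eval z‖ - 1)]
  · rw [Polynomial.sum_sq_norm_coeff_eq_circleAverage]
    have hi : CircleIntegrable (fun z => ‖h z‖) 0 1 :=
      ContinuousOn.circleIntegrable zero_le_one hcs.norm
    have hi2 : CircleIntegrable (fun z => (8:ℝ) • ‖h z‖) 0 1 := hi.const_smul
    calc circleAverage (fun z => ‖P.eval z‖ ^ 2) 0 1
        ≤ circleAverage (fun z => (8:ℝ) • ‖h z‖ + 10) 0 1 := by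
          refine circleAverage_mono ?_ (hi2.add (circleIntegrable_const _ _ _)) ?_
          · exact ContinuousOn.circleIntegrable zero_le_one (by fun_prop)
          · intro z hz
            rw [abs_one] at hz
            have h1 := hP z (sphere_subset_closedBall hz)
            have h2 : ‖P.eval z‖ ≤ ‖Complex.exp (Q.eval z / 2)‖ + 1 := by
              have := norm_le_norm_add_norm_sub (Complex.exp (Q.eval z / 2)) (P.eval z)
              linarith
            have h3 := hupp z hz
            rw [← hnorm] at h3
            simp only [smul_eq_mul]
            nlinarith [norm_nonneg (Complex.exp (Q.eval z / 2)), norm_nonneg (P.eval z),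
              sq_nonneg (‖Complex.exp (Q.eval z / 2)‖ - 1)]
      _ = 8 * circleAverage (fun z => ‖h z‖) 0 1 + 10 := by
          rw [circleAverage_fun_add hi2 (circleIntegrable_const _ _ _), circleAverage_fun_smul,
            circleAverage_const, smul_eq_mul]

open Polynomial in
/-- The Fejér–Riesz inequality for squares of polynomials. -/
theorem norm_integral_sq_eval_le (p : ℂ[X]) :
    ‖∫ x in (-1:ℝ)..1, (p.eval (x : ℂ)) ^ 2‖ ≤ 2 * π * ∑ i ∈ p.support, ‖p.coeff i‖ ^ 2 := by
  have hq : Differentiable ℂ fun z => (p.eval z) ^ 2 := by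
    have := p.differentiable
    fun_prop
  obtain ⟨Q, hQ⟩ := hq.isExactOn_univ
  have hpc : Continuous fun z => p.eval z := p.continuous
  have h1 : ∫ x in (-1:ℝ)..1, (p.eval (x : ℂ)) ^ 2 = Q 1 - Q (-1) := by
    rw [intervalIntegral.integral_eq_sub_of_hasDerivAt (f := fun x : ℝ => Q x)]
    · simp
    · exact fun x _ => (hQ x trivial).comp_ofReal
    · exact Continuous.intervalIntegrable (by fun_prop) _ _
  have h2 : ∫ θ in (0:ℝ)..π, (p.eval (circleMap 0 1 θ)) ^ 2 * (circleMap 0 1 θ * Complex.I)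
      = Q (-1) - Q 1 := by
    rw [intervalIntegral.integral_eq_sub_of_hasDerivAt (f := fun θ : ℝ => Q (circleMap 0 1 θ))]
    · simp [circleMap]
    · exact fun x _ => (hQ _ trivial).comp x (hasDerivAt_circleMap 0 1 x)
    · exact Continuous.intervalIntegrable (by fun_prop) _ _
  rw [h1, norm_sub_rev, ← h2, Polynomial.sum_sq_norm_coeff_eq_circleAverage, circleAverage_def,
    smul_eq_mul, mul_inv_cancel_left₀ (by positivity)]
  calc _ ≤ ∫ θ in (0:ℝ)..π,
        ‖(p.eval (circleMap 0 1 θ)) ^ 2 * (circleMap 0 1 θ * Complex.I)‖ :=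
        intervalIntegral.norm_integral_le_integral_norm pi_pos.le
    _ = ∫ θ in (0:ℝ)..π, ‖p.eval (circleMap 0 1 θ)‖ ^ 2 := by simp
    _ ≤ ∫ θ in (0:ℝ)..2 * π, ‖p.eval (circleMap 0 1 θ)‖ ^ 2 := by
        refine intervalIntegral.integral_mono_interval le_rfl pi_pos.le
          (by linarith [pi_pos]) (Filter.Eventually.of_forall fun _ => by positivity) ?_
        exact Continuous.intervalIntegrable (by fun_prop) _ _

/-- A Hilbert-type inequality for real polynomials on the unit interval. -/
theorem integral_sum_mul_pow_sq_le (s : Finset ℕ) (a : ℕ → ℝ) :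
    ∫ x in (0:ℝ)..1, (∑ i ∈ s, a i * x ^ i) ^ 2 ≤ 2 * π * ∑ i ∈ s, a i ^ 2 := by
  classical
  let p : Polynomial ℂ := ∑ i ∈ s, Polynomial.monomial i (a i : ℂ)
  have hcoeff : ∀ i, p.coeff i = if i ∈ s then (a i : ℂ) else 0 := by
    intro i
    simp [p, Polynomial.finsetSum_coeff, Polynomial.coeff_monomial]
  have hsum : ∑ i ∈ p.support, ‖p.coeff i‖ ^ 2 = ∑ i ∈ s, a i ^ 2 := by
    have hsub : p.support ⊆ s := by
      intro i hi
      by_contra hn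
      simp [hcoeff, hn] at hi
    rw [Finset.sum_subset hsub]
    · refine Finset.sum_congr rfl fun i hi => ?_
      simp [hcoeff, hi]
    · intro i _ hi
      simp [Polynomial.notMem_support_iff.1 hi]
  have heval : ∀ x : ℝ, (p.eval (x : ℂ)) ^ 2 = (((∑ i ∈ s, a i * x ^ i) ^ 2 : ℝ) : ℂ) := by
    intro x
    simp [p, Polynomial.eval_finsetSum]
  have hFR := norm_integral_sq_eval_le p
  simp_rw [hsum, heval] at hFR
  rw [intervalIntegral.integral_ofReal, Complex.norm_real] at hFR
  refine le_trans ?_ ((le_abs_self _).trans hFR)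
  refine intervalIntegral.integral_mono_interval (by norm_num) zero_le_one le_rfl
    (Filter.Eventually.of_forall fun _ => by positivity) ?_
  exact Continuous.intervalIntegrable (by fun_prop) _ _

/-- The maximum modulus of `h` on the closed disc of radius `s`. -/
noncomputable def maxModulus (h : ℂ → ℂ) (s : ℝ) : ℝ :=
  sSup ((fun z => ‖h z‖) '' closedBall (0:ℂ) s)

theorem bddAbove_norm_image_closedBall {h : ℂ → ℂ} (hh : ContinuousOn h (ball (0:ℂ) 1)) {s : ℝ}
    (hs : s < 1) : BddAbove ((fun z => ‖h z‖) '' closedBall (0:ℂ) s) :=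
  (isCompact_closedBall _ _).bddAbove_image (hh.norm.mono (closedBall_subset_ball hs))

theorem norm_le_maxModulus {h : ℂ → ℂ} (hh : ContinuousOn h (ball (0:ℂ) 1)) {s : ℝ}
    (hs : s < 1) {z : ℂ} (hz : ‖z‖ ≤ s) : ‖h z‖ ≤ maxModulus h s :=
  le_csSup (bddAbove_norm_image_closedBall hh hs) ⟨z, by simpa using hz, rfl⟩

theorem monotoneOn_maxModulus {h : ℂ → ℂ} (hh : ContinuousOn h (ball (0:ℂ) 1)) :
    MonotoneOn (maxModulus h) (Set.Ico 0 1) := fun _ hs _ ht hst =>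
  csSup_le_csSup (bddAbove_norm_image_closedBall hh ht.2)
    ((nonempty_closedBall.2 hs.1).image _) (Set.image_mono (closedBall_subset_closedBall hst))

theorem maxModulus_nonneg (h : ℂ → ℂ) (s : ℝ) : 0 ≤ maxModulus h s :=
  Real.sSup_nonneg (by rintro _ ⟨z, _, rfl⟩; positivity)

theorem intervalIntegrable_maxModulus_of_lt {h : ℂ → ℂ} (hh : ContinuousOn h (ball (0:ℂ) 1))
    {ρ : ℝ} (hρ : ρ ∈ Set.Ioo (0:ℝ) 1) :
    IntervalIntegrable (maxModulus h) MeasureTheory.volume 0 ρ := by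
  refine MonotoneOn.intervalIntegrable ((monotoneOn_maxModulus hh).mono ?_)
  rw [Set.uIcc_of_le hρ.1.le]
  exact fun x hx => ⟨hx.1, hx.2.trans_lt hρ.2⟩

/-- The radial integral of the maximum modulus is controlled by the `H¹` norm. -/
theorem integral_maxModulus_le {h : ℂ → ℂ} (hh : DifferentiableOn ℂ h (ball (0:ℂ) 1)) {ρ : ℝ}
    (hρ : ρ ∈ Set.Ioo (0:ℝ) 1) :
    ∫ s in (0:ℝ)..ρ, maxModulus h s ≤
      4 * π * (8 * circleAverage (fun z => ‖h z‖) 0 ρ + 10) + 2 := by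
  have hmaps : Set.MapsTo (fun z : ℂ => (ρ : ℂ) * z) (closedBall (0:ℂ) 1) (ball (0:ℂ) 1) := by
    intro z hz
    simp only [mem_closedBall, dist_zero_right, mem_ball, norm_mul, Complex.norm_real,
      norm_eq_abs, abs_of_pos hρ.1] at hz ⊢
    nlinarith [hρ.1, hρ.2, norm_nonneg z]
  have hdil : DiffContOnCl ℂ (fun z => h ((ρ : ℂ) * z)) (ball (0:ℂ) 1) := by
    refine DifferentiableOn.diffContOnCl ?_
    rw [closure_ball _ one_ne_zero]
    exact hh.comp (by fun_prop) hmaps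
  obtain ⟨P, hP, hsum⟩ := exists_polynomial_sq_majorant hdil
  have havg : circleAverage (fun z => ‖h ((ρ : ℂ) * z)‖) 0 1 =
      circleAverage (fun z => ‖h z‖) 0 ρ := by
    simp [circleAverage_def, circleMap]
  rw [havg] at hsum
  let A : ℝ → ℝ := fun s => ∑ i ∈ P.support, ‖P.coeff i‖ * s ^ i
  have hAc : Continuous A := by fun_prop
  have hA : ∫ s in (0:ℝ)..1, A s ^ 2 ≤ 2 * π * ∑ i ∈ P.support, ‖P.coeff i‖ ^ 2 :=
    integral_sum_mul_pow_sq_le _ _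
  have hbound : ∀ s ∈ Set.Icc (0:ℝ) 1, maxModulus h (ρ * s) ≤ 2 * A s ^ 2 + 2 := by
    intro s hs
    refine csSup_le ((nonempty_closedBall.2 (mul_nonneg hρ.1.le hs.1)).image _) ?_
    rintro _ ⟨z, hz, rfl⟩
    have hρ0 : (ρ : ℂ) ≠ 0 := by exact_mod_cast hρ.1.ne'
    have hw : ‖z / ρ‖ ≤ s := by
      rw [norm_div, Complex.norm_real, norm_eq_abs, abs_of_pos hρ.1, div_le_iff₀ hρ.1, mul_comm]
      simpa using hz
    have h1 := hP (z / ρ) (by simpa using hw.trans hs.2)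
    simp only [mul_div_cancel₀ z hρ0] at h1
    have h2 : ‖P.eval (z / ρ)‖ ≤ A s := by
      rw [Polynomial.eval_eq_sum, Polynomial.sum_def]
      refine (norm_sum_le _ _).trans (Finset.sum_le_sum fun i _ => ?_)
      rw [norm_mul, norm_pow]
      gcongr
    have h3 : ‖P.eval (z / ρ)‖ ^ 2 ≤ A s ^ 2 := by gcongr
    change ‖h z‖ ≤ _
    linarith
  have hint := intervalIntegrable_maxModulus_of_lt hh.continuousOn hρ
  have hint' : IntervalIntegrable (fun s => maxModulus h (ρ * s)) MeasureTheory.volume 0 1 := by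
    simpa [hρ.1.ne'] using hint.comp_mul_left (c := ρ)
  have hmono : ∫ s in (0:ℝ)..1, maxModulus h (ρ * s) ≤ ∫ s in (0:ℝ)..1, (2 * A s ^ 2 + 2) :=
    intervalIntegral.integral_mono_on zero_le_one hint'
      (Continuous.intervalIntegrable (by fun_prop) _ _) hbound
  have hcalc : ∫ s in (0:ℝ)..1, (2 * A s ^ 2 + 2) = 2 * (∫ s in (0:ℝ)..1, A s ^ 2) + 2 := by
    rw [intervalIntegral.integral_add (Continuous.intervalIntegrable (by fun_prop) _ _)
      (Continuous.intervalIntegrable (by fun_prop) _ _), intervalIntegral.integral_const_mul]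
    simp
  have hscale : ∫ s in (0:ℝ)..ρ, maxModulus h s =
      ρ * ∫ s in (0:ℝ)..1, maxModulus h (ρ * s) := by
    simp
  have hnn : 0 ≤ ∫ s in (0:ℝ)..1, maxModulus h (ρ * s) :=
    intervalIntegral.integral_nonneg zero_le_one fun _ _ => maxModulus_nonneg _ _
  have h2pi : 2 * π * ∑ i ∈ P.support, ‖P.coeff i‖ ^ 2 ≤
      2 * π * (8 * circleAverage (fun z => ‖h z‖) 0 ρ + 10) := by gcongr
  rw [hscale]
  calc ρ * ∫ s in (0:ℝ)..1, maxModulus h (ρ * s)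
      ≤ ∫ s in (0:ℝ)..1, maxModulus h (ρ * s) := mul_le_of_le_one_left hnn hρ.2.le
    _ ≤ 4 * π * (8 * circleAverage (fun z => ‖h z‖) 0 ρ + 10) + 2 := by linarith

/-- The maximum modulus of an `H¹` function is integrable along the radius. -/
theorem intervalIntegrable_maxModulus {h : ℂ → ℂ} (hh : DifferentiableOn ℂ h (ball (0:ℂ) 1))
    (hH1 : memH1 h) : IntervalIntegrable (maxModulus h) MeasureTheory.volume 0 1 := by
  obtain ⟨C, hC⟩ := hH1
  rw [intervalIntegrable_iff_integrableOn_Ioc_of_le zero_le_one]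
  obtain ⟨ρ, -, hρ, hlim⟩ := exists_seq_strictMono_tendsto' (zero_lt_one (α := ℝ))
  refine MeasureTheory.integrableOn_Ioc_of_intervalIntegral_norm_bounded_right
    (I := 4 * π * (8 * ((2 * π)⁻¹ * C) + 10) + 2) (fun n => ?_) hlim
    (Filter.Eventually.of_forall fun n => ?_)
  · rw [← intervalIntegrable_iff_integrableOn_Ioc_of_le (hρ n).1.le]
    exact intervalIntegrable_maxModulus_of_lt hh.continuousOn (hρ n)
  · simp_rw [norm_eq_abs, abs_of_nonneg (maxModulus_nonneg h _)]
    rw [← intervalIntegral.integral_of_le (hρ n).1.le]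
    refine (integral_maxModulus_le hh (hρ n)).trans ?_
    have : circleAverage (fun z => ‖h z‖) 0 (ρ n) ≤ (2 * π)⁻¹ * C := by
      rw [circleAverage_def, smul_eq_mul]
      have := hC (ρ n) ⟨(hρ n).1.le, (hρ n).2⟩
      simp only [circleMap, zero_add]
      gcongr
    gcongr

/-- The radial primitive of an `H¹` function is continuous on the closed unit disc. -/
theorem continuousOn_radial_primitive {h : ℂ → ℂ} (hh : DifferentiableOn ℂ h (ball (0:ℂ) 1))
    (hH1 : memH1 h) :
    ContinuousOn (fun z => z * ∫ s in (0:ℝ)..1, h ((s : ℂ) * z)) (closedBall (0:ℂ) 1) := by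
  refine continuousOn_id.mul fun z hz => ?_
  have hnorm : ∀ s ∈ Set.Ioo (0:ℝ) 1, ∀ w ∈ closedBall (0:ℂ) 1, ‖(s : ℂ) * w‖ ≤ s := by
    intro s hs w hw
    rw [norm_mul, Complex.norm_real, norm_eq_abs, abs_of_pos hs.1]
    exact mul_le_of_le_one_right hs.1.le (by simpa using hw)
  have hmem : ∀ s ∈ Set.Ioo (0:ℝ) 1, ∀ w ∈ closedBall (0:ℂ) 1, (s : ℂ) * w ∈ ball (0:ℂ) 1 := by
    intro s hs w hw
    simpa using (hnorm s hs w hw).trans_lt hs.2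
  have hne : ∀ᵐ s : ℝ, s ∈ Set.uIoc (0:ℝ) 1 → s ∈ Set.Ioo (0:ℝ) 1 := by
    filter_upwards [MeasureTheory.Measure.ae_ne MeasureTheory.volume (1:ℝ)] with s hs hs'
    rw [Set.uIoc_of_le zero_le_one] at hs'
    exact ⟨hs'.1, lt_of_le_of_ne hs'.2 hs⟩
  refine intervalIntegral.continuousWithinAt_of_dominated_interval (bound := maxModulus h)
    ?_ ?_ (intervalIntegrable_maxModulus hh hH1) ?_
  · filter_upwards [self_mem_nhdsWithin] with w hw
    rw [Set.uIoc_of_le zero_le_one,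
      ← MeasureTheory.Measure.restrict_congr_set MeasureTheory.Ioo_ae_eq_Ioc]
    exact ContinuousOn.aestronglyMeasurable
      (hh.continuousOn.comp (by fun_prop) fun s hs => hmem s hs w hw) measurableSet_Ioo
  · filter_upwards [self_mem_nhdsWithin] with w hw
    filter_upwards [hne] with s hs hs'
    exact norm_le_maxModulus hh.continuousOn (hs hs').2 (hnorm s (hs hs') w hw)
  · filter_upwards [hne] with s hs hs'
    exact (hh.continuousOn.comp (by fun_prop) fun w hw => hmem s (hs hs') w hw) z hz

/-- The radial primitive of a holomorphic function on the disc is a primitive. -/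
theorem hasDerivAt_radial_primitive {h : ℂ → ℂ} (hh : DifferentiableOn ℂ h (ball (0:ℂ) 1))
    {z : ℂ} (hz : z ∈ ball (0:ℂ) 1) :
    HasDerivAt (fun z => z * ∫ s in (0:ℝ)..1, h ((s : ℂ) * z)) (h z) z := by
  obtain ⟨H, hH0, hH⟩ := hh.isExactOn_ball.with_val_at 0 0
  refine (hH z hz).congr_of_eventuallyEq ?_
  filter_upwards [isOpen_ball.mem_nhds hz] with w hw
  have hmem : ∀ s ∈ Set.uIcc (0:ℝ) 1, (s : ℂ) * w ∈ ball (0:ℂ) 1 := by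
    intro s hs
    rw [Set.uIcc_of_le zero_le_one] at hs
    simp only [mem_ball, dist_zero_right, norm_mul, Complex.norm_real, norm_eq_abs,
      abs_of_nonneg hs.1] at hw ⊢
    exact (mul_le_of_le_one_left (norm_nonneg w) hs.2).trans_lt hw
  rw [← intervalIntegral.integral_const_mul,
    intervalIntegral.integral_eq_sub_of_hasDerivAt (f := fun s : ℝ => H ((s : ℂ) * w))]
  · simp [hH0]
  · intro s hs
    have h1 : HasDerivAt (fun s : ℝ => (s : ℂ) * w) w s := by
      simpa using (Complex.ofRealCLM.hasDerivAt (x := s)).mul_const w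
    have := (hH _ (hmem s hs)).comp s h1
    rwa [mul_comm] at this
  · refine ContinuousOn.intervalIntegrable ?_
    exact continuousOn_const.mul (hh.continuousOn.comp (by fun_prop) hmem)

/-- The derivative of a function in the disc algebra is `o((1 - |z|)⁻¹)` at the boundary. -/
theorem memA0minus1_of_hasDerivAt {F h : ℂ → ℂ} (hF : ContinuousOn F (closedBall (0:ℂ) 1))
    (hd : ∀ z ∈ ball (0:ℂ) 1, HasDerivAt F (h z) z) : memA0minus1 h := by
  intro ε hε
  have huc := (isCompact_closedBall (0:ℂ) 1).uniformContinuousOn_of_continuous hF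
  obtain ⟨δ, hδ, hFδ⟩ := Metric.uniformContinuousOn_iff.1 huc (ε / 4) (by positivity)
  refine ⟨1 - δ, by linarith, fun z hz hrz => ?_⟩
  have hz1 : ‖z‖ < 1 := by simpa using hz
  set R := (1 - ‖z‖) / 2 with hR
  have hR0 : 0 < R := by linarith
  have hsub : closedBall z R ⊆ ball (0:ℂ) 1 := by
    refine fun w hw => ?_
    rw [mem_closedBall, dist_eq_norm] at hw
    have := norm_le_norm_add_norm_sub z w
    rw [norm_sub_rev] at this
    rw [mem_ball_zero_iff]
    linarith
  have hdc : DiffContOnCl ℂ (fun w => F w - F z) (ball z R) := by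
    refine DifferentiableOn.diffContOnCl fun w hw => ?_
    rw [closure_ball _ hR0.ne'] at hw
    exact ((hd w (hsub hw)).differentiableAt.sub_const _).differentiableWithinAt
  have hest := Complex.norm_deriv_le_of_forall_mem_sphere_norm_le hR0 hdc (C := ε / 4) ?_
  · rw [((hd z hz).sub_const (F z)).deriv, le_div_iff₀ hR0] at hest
    nlinarith
  · intro w hw
    rw [← dist_eq_norm]
    refine (hFδ w (ball_subset_closedBall (hsub (sphere_subset_closedBall hw))) z
      (ball_subset_closedBall hz) ?_).le
    rw [mem_sphere.1 hw]
    linarith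

theorem memH1.mul_of_norm_le {f k : ℂ → ℂ} (hf : memH1 f)
    (hfc : ContinuousOn f (ball (0:ℂ) 1)) (hkc : ContinuousOn k (ball (0:ℂ) 1)) {M : ℝ}
    (hM : 0 ≤ M) (hk : ∀ z ∈ ball (0:ℂ) 1, ‖k z‖ ≤ M) : memH1 fun z => f z * k z := by
  obtain ⟨C, hC⟩ := hf
  refine ⟨M * C, fun r hr => ?_⟩
  have hmem : ∀ θ : ℝ, (r : ℂ) * Complex.exp ((θ : ℂ) * Complex.I) ∈ ball (0:ℂ) 1 := by
    intro θ
    simpa [Complex.norm_exp_ofReal_mul_I, abs_of_nonneg hr.1] using hr.2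
  have hf' := hfc.comp_continuous
    (f := fun θ : ℝ => (r : ℂ) * Complex.exp ((θ : ℂ) * Complex.I)) (by fun_prop) hmem
  have hk' := hkc.comp_continuous
    (f := fun θ : ℝ => (r : ℂ) * Complex.exp ((θ : ℂ) * Complex.I)) (by fun_prop) hmem
  refine le_trans ?_ (mul_le_mul_of_nonneg_left (hC r hr) hM)
  rw [← intervalIntegral.integral_const_mul]
  refine intervalIntegral.integral_mono_on two_pi_pos.le ?_ ?_ fun θ _ => ?_
  · exact (hf'.mul hk').norm.intervalIntegrable _ _
  · exact (continuous_const.mul hf'.norm).intervalIntegrable _ _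
  · rw [norm_mul, mul_comm]
    exact mul_le_mul_of_nonneg_right (hk _ (hmem θ)) (norm_nonneg _)

/-- For `g` analytic on `𝔻` with `0 < m ≤ |g'| ≤ M`:
(a) if `f ∈ H¹` then `V_g f` extends continuously to the closed disc;
(b) if `V_g f` extends continuously to the closed disc then `(1-|z|)|f(z)| → 0` as `|z| → 1⁻`.
That is, `H¹ ⊆ [V_g, A(𝔻)] ⊆ A₀^{-1}`. -/
theorem H1_subset_optimalDomain_discAlgebra_subset_A0minus1
    (g : ℂ → ℂ) (hg : DifferentiableOn ℂ g (ball (0:ℂ) 1))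
    (m M : ℝ) (hm : 0 < m)
    (hg' : ∀ z ∈ ball (0:ℂ) 1, m ≤ ‖deriv g z‖ ∧ ‖deriv g z‖ ≤ M) :
    (∀ f : ℂ → ℂ, DifferentiableOn ℂ f (ball (0:ℂ) 1) → memH1 f →
      memDiscAlgebra (Vg g f)) ∧
    (∀ f : ℂ → ℂ, DifferentiableOn ℂ f (ball (0:ℂ) 1) →
      memDiscAlgebra (Vg g f) → memA0minus1 f) := by
  have hdg : DifferentiableOn ℂ (deriv g) (ball (0:ℂ) 1) := hg.deriv isOpen_ball
  have hM : 0 ≤ M := (norm_nonneg _).trans (hg' 0 (by simp)).2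
  refine ⟨fun f hf hH1 => ⟨Vg g f, ?_, fun _ _ => rfl⟩, fun f hf hV => ?_⟩
  · exact continuousOn_radial_primitive (h := fun z => f z * deriv g z) (hf.mul hdg)
      (hH1.mul_of_norm_le hf.continuousOn hdg.continuousOn hM fun z hz => (hg' z hz).2)
  · obtain ⟨F, hF, hFV⟩ := hV
    have hA : memA0minus1 fun z => f z * deriv g z := by
      refine memA0minus1_of_hasDerivAt hF fun z hz => ?_
      refine HasDerivAt.congr_of_eventuallyEq
        (hasDerivAt_radial_primitive (h := fun z => f z * deriv g z) (hf.mul hdg) hz) ?_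
      filter_upwards [isOpen_ball.mem_nhds hz] with w hw
      exact hFV w hw
    intro ε hε
    obtain ⟨r, hr, h⟩ := hA (ε * m) (by positivity)
    refine ⟨r, hr, fun z hz hrz => ?_⟩
    have h1 := h z hz hrz
    rw [norm_mul, ← mul_assoc] at h1
    have h2 : 0 ≤ (1 - ‖z‖) * ‖f z‖ :=
      mul_nonneg (sub_nonneg.2 (by simpa using (mem_ball_zero_iff.1 hz).le)) (norm_nonneg _)
    exact lt_of_mul_lt_mul_right
      ((mul_le_mul_of_nonneg_left (hg' z hz).1 h2).trans_lt h1) hm.le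
end

section
/- Let 1 ≤ p < q < ∞ and set α := 1/p − 1/q (so 0 < α ≤ 1). Let g be analytic on 𝔻 with sup_{z∈𝔻}(1−|z|)^{1−α}|g'(z)| < ∞ (i.e. g belongs to the Lipschitz space Λ_α). Then for every f ∈ H^p one has V_g f ∈ H^q; that is, H^p ⊆ [V_g, H^q]. -/
open Metric Real

/-- `f` belongs to the Hardy space `H^p`: `sup_{0≤r<1} ∫₀^{2π} |f(r e^{iθ})|^p dθ < ∞`. -/
def memHp (p : ℝ) (f : ℂ → ℂ) : Prop :=
  ∃ C : ℝ, ∀ r ∈ Set.Ico (0:ℝ) 1,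
    (∫ θ in (0:ℝ)..(2 * π),
      ‖f ((r : ℂ) * Complex.exp ((θ : ℂ) * Complex.I))‖ ^ p) ≤ C

open MeasureTheory
open scoped ENNReal

lemma integral_mul_one_sub_rpow_le {p q M B δ : ℝ} (hp : 0 < p) (hpq : p < q)
    (hB : 0 < B) (hδ : 0 < δ) (hδ1 : δ ≤ 1) {φ : ℝ → ℝ}
    (hφM : ∀ s ∈ Set.Ico (0:ℝ) 1, φ s ≤ M)
    (hφB : ∀ s ∈ Set.Ico (0:ℝ) 1, φ s ≤ B * (1 - s) ^ (-(1 / p)))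
    (hint : IntervalIntegrable (fun s => φ s * (1 - s) ^ (1 / p - 1 / q - 1))
      volume 0 1) :
    ∫ s in (0:ℝ)..1, φ s * (1 - s) ^ (1 / p - 1 / q - 1) ≤
      M * (δ ^ (1 / p - 1 / q) / (1 / p - 1 / q)) + B * (q * δ ^ (-(1 / q))) := by
  have hq : 0 < q := hp.trans hpq
  have hα : 0 < 1 / p - 1 / q := sub_pos.2 (one_div_lt_one_div_of_lt hp hpq)
  set α := 1 / p - 1 / q with hαdef
  have hmem : (1 - δ) ∈ Set.uIcc (0:ℝ) 1 := by
    rw [Set.uIcc_of_le zero_le_one]; constructor <;> linarith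
  have hi1 : IntervalIntegrable (fun s => φ s * (1 - s) ^ (α - 1))
      volume 0 (1 - δ) :=
    hint.mono_set (Set.uIcc_subset_uIcc Set.left_mem_uIcc hmem)
  have hi2 : IntervalIntegrable (fun s => φ s * (1 - s) ^ (α - 1))
      volume (1 - δ) 1 :=
    hint.mono_set (Set.uIcc_subset_uIcc hmem Set.right_mem_uIcc)
  have hnot : (0:ℝ) ∉ Set.uIcc δ 1 := by
    rw [Set.uIcc_of_le hδ1]; intro h; linarith [h.1]
  have hj1 : IntervalIntegrable (fun s : ℝ => B * (1 - s) ^ (-(1 / q) - 1))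
      volume 0 (1 - δ) := by
    have := (intervalIntegral.intervalIntegrable_rpow (μ := volume)
      (r := -(1 / q) - 1) (Or.inr hnot)).symm.comp_sub_left 1
    simpa using this.const_mul B
  have hj2 : IntervalIntegrable (fun s : ℝ => M * (1 - s) ^ (α - 1))
      volume (1 - δ) 1 := by
    have := (intervalIntegral.intervalIntegrable_rpow' (a := 0) (b := δ)
      (r := α - 1) (by linarith)).symm.comp_sub_left 1
    simpa using this.const_mul M
  rw [← intervalIntegral.integral_add_adjacent_intervals hi1 hi2, add_comm]
  refine add_le_add ?_ ?_
  · calc ∫ s in (1 - δ)..1, φ s * (1 - s) ^ (α - 1)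
        ≤ ∫ s in (1 - δ)..1, M * (1 - s) ^ (α - 1) := by
          refine intervalIntegral.integral_mono_on_of_le_Ioo (by linarith) hi2 hj2 ?_
          intro s hs
          have : 0 ≤ 1 - s := by linarith [hs.2]
          exact mul_le_mul_of_nonneg_right (hφM s ⟨by linarith [hs.1], hs.2⟩) (by positivity)
      _ = M * (δ ^ α / α) := by
          rw [intervalIntegral.integral_const_mul,
            intervalIntegral.integral_comp_sub_left (fun x => x ^ (α - 1)) 1]
          rw [integral_rpow (Or.inl (by linarith))]
          simp [Real.zero_rpow hα.ne']
  · calc ∫ s in (0:ℝ)..(1 - δ), φ s * (1 - s) ^ (α - 1)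
        ≤ ∫ s in (0:ℝ)..(1 - δ), B * (1 - s) ^ (-(1 / q) - 1) := by
          refine intervalIntegral.integral_mono_on_of_le_Ioo (by linarith) hi1 hj1 ?_
          intro s hs
          have h1 : 0 < 1 - s := by linarith [hs.2]
          have := mul_le_mul_of_nonneg_right (hφB s ⟨hs.1.le, by linarith⟩)
            (by positivity : 0 ≤ (1 - s) ^ (α - 1))
          rwa [mul_assoc, ← Real.rpow_add h1,
            show -(1 / p) + (α - 1) = -(1 / q) - 1 by rw [hαdef]; ring] at this
      _ ≤ B * (q * δ ^ (-(1 / q))) := by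
          rw [intervalIntegral.integral_const_mul,
            intervalIntegral.integral_comp_sub_left (fun x => x ^ (-(1 / q) - 1)) 1]
          have hne : -(1 / q) - 1 ≠ -1 := by
            have : 0 < 1 / q := by positivity
            linarith
          rw [integral_rpow (Or.inr ⟨hne, by simpa using hnot⟩)]
          refine mul_le_mul_of_nonneg_left ?_ hB.le
          have : -(1 / q) - 1 + 1 = -(1 / q) := by ring
          rw [this, sub_zero, sub_sub_cancel, Real.one_rpow, div_neg, ← neg_div, neg_sub,
            div_div_eq_mul_div, div_one, mul_comm]
          exact mul_le_mul_of_nonneg_left (by linarith) hq.le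

lemma integral_mul_one_sub_rpow_le_rpow {p q M B : ℝ} (hp : 0 < p) (hpq : p < q)
    (hB : 0 < B) {φ : ℝ → ℝ}
    (hφM : ∀ s ∈ Set.Ico (0:ℝ) 1, φ s ≤ M)
    (hφB : ∀ s ∈ Set.Ico (0:ℝ) 1, φ s ≤ B * (1 - s) ^ (-(1 / p)))
    (hint : IntervalIntegrable (fun s => φ s * (1 - s) ^ (1 / p - 1 / q - 1))
      volume 0 1) :
    ∫ s in (0:ℝ)..1, φ s * (1 - s) ^ (1 / p - 1 / q - 1) ≤
      (1 / (1 / p - 1 / q) + q) * B ^ (1 - p / q) * (max M B) ^ (p / q) := by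
  have hq : 0 < q := hp.trans hpq
  have hm : 0 < max M B := lt_max_of_lt_right hB
  set N := max M B
  have hδ : 0 < (B / N) ^ p := by positivity
  have hδ1 : (B / N) ^ p ≤ 1 :=
    Real.rpow_le_one (by positivity) ((div_le_one hm).2 (le_max_right _ _)) hp.le
  refine (integral_mul_one_sub_rpow_le (M := N) hp hpq hB hδ hδ1
    (fun s hs => (hφM s hs).trans (le_max_left _ _)) hφB hint).trans_eq ?_
  rw [← Real.rpow_mul (by positivity), ← Real.rpow_mul (by positivity),
    Real.div_rpow hB.le hm.le, Real.div_rpow hB.le hm.le]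
  have e1 : p * (1 / p - 1 / q) = 1 - p / q := by field_simp
  have e2 : p * (-(1 / q)) = - (p / q) := by ring
  rw [e1, e2, Real.rpow_sub hm, Real.rpow_sub hB, Real.rpow_neg hB.le, Real.rpow_neg hm.le,
    Real.rpow_one, Real.rpow_one]
  have : 1 / p - 1 / q ≠ 0 := (sub_pos.2 (one_div_lt_one_div_of_lt hp hpq)).ne'
  have h1 : B ^ (p / q) ≠ 0 := by positivity
  have h2 : N ^ (p / q) ≠ 0 := by positivity
  generalize 1 / p - 1 / q = α at *
  field_simp

lemma exists_entire_add_conj_of_mem_span_fourier {T : C(AddCircle (1:ℝ), ℂ)}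
    (hT : T ∈ Submodule.span ℂ (Set.range (fourier (T := (1:ℝ))))) :
    ∃ Q₁ Q₂ : ℂ → ℂ, Differentiable ℂ Q₁ ∧ Differentiable ℂ Q₂ ∧
      ∀ x : AddCircle (1:ℝ), T x = Q₁ (AddCircle.toCircle x) +
        (starRingEnd ℂ) (Q₂ (AddCircle.toCircle x)) := by
  induction hT using Submodule.span_induction with
  | mem T hT =>
    obtain ⟨n, rfl⟩ := hT
    obtain ⟨m, rfl | rfl⟩ := n.eq_nat_or_neg
    · refine ⟨fun z => z ^ m, fun _ => 0, by fun_prop, by fun_prop, fun x => ?_⟩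
      simp [fourier_apply, AddCircle.toCircle_nsmul]
    · refine ⟨fun _ => 0, fun z => z ^ m, by fun_prop, by fun_prop, fun x => ?_⟩
      simp only [fourier_apply, neg_smul, natCast_zsmul, AddCircle.toCircle_neg,
        AddCircle.toCircle_nsmul, Circle.coe_inv_eq_conj, Circle.coe_pow, map_pow, zero_add]
  | zero => exact ⟨0, 0, by fun_prop, by fun_prop, by simp⟩
  | add S T _ _ hS hT =>
    obtain ⟨A₁, A₂, hA₁, hA₂, hA⟩ := hS
    obtain ⟨B₁, B₂, hB₁, hB₂, hB⟩ := hT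
    refine ⟨A₁ + B₁, A₂ + B₂, hA₁.add hB₁, hA₂.add hB₂, fun x => ?_⟩
    simp only [ContinuousMap.add_apply, hA, hB, Pi.add_apply, map_add]
    ring
  | smul c T _ hT =>
    obtain ⟨A₁, A₂, hA₁, hA₂, hA⟩ := hT
    refine ⟨c • A₁, (starRingEnd ℂ) c • A₂, hA₁.const_smul _, hA₂.const_smul _, fun x => ?_⟩
    simp only [ContinuousMap.smul_apply, hA, Pi.smul_apply, smul_eq_mul, map_mul,
      Complex.conj_conj]
    ring

/-- Real parts of entire functions are uniformly dense in the continuous real functions on the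
unit circle. -/
lemma exists_entire_re_approx_on_sphere {v : ℂ → ℝ} (hv : ContinuousOn v (sphere 0 1)) {ε : ℝ}
    (hε : 0 < ε) :
    ∃ Q : ℂ → ℂ, Differentiable ℂ Q ∧ ∀ z ∈ sphere (0:ℂ) 1, |v z - (Q z).re| ≤ ε := by
  let L : C(AddCircle (1:ℝ), ℂ) :=
    ⟨fun x => (v (AddCircle.toCircle x) : ℂ), Complex.continuous_ofReal.comp
      (hv.comp_continuous (continuous_subtype_val.comp AddCircle.continuous_toCircle)
        fun x => by simp [Circle.norm_coe])⟩
  have hL : L ∈ (Submodule.span ℂ (Set.range (fourier (T := (1:ℝ))))).topologicalClosure := by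
    rw [span_fourier_closure_eq_top]; trivial
  obtain ⟨T, hT, hLT⟩ := Metric.mem_closure_iff.1 hL ε hε
  obtain ⟨Q₁, Q₂, h₁, h₂, hQ⟩ := exists_entire_add_conj_of_mem_span_fourier hT
  refine ⟨Q₁ + Q₂, h₁.add h₂, fun z hz => ?_⟩
  obtain ⟨x, hx⟩ := (AddCircle.homeomorphCircle (T := (1:ℝ)) one_ne_zero).surjective
    ⟨z, by simpa [Submonoid.unitSphere] using hz⟩
  have hxz : (AddCircle.toCircle x : ℂ) = z := by
    rw [← AddCircle.homeomorphCircle_apply one_ne_zero, hx]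
  have hd := (ContinuousMap.dist_apply_le_dist (f := L) (g := T) x).trans hLT.le
  rw [Complex.dist_eq, hQ x, hxz] at hd
  refine le_trans ?_ ((Complex.abs_re_le_norm _).trans hd)
  simp [L, hxz]

lemma poissonKernel_nonneg_of_mem_sphere {w z : ℂ} (hw : w ∈ ball (0:ℂ) 1)
    (hz : z ∈ sphere (0:ℂ) 1) : 0 ≤ poissonKernel 0 w z := by
  have hw' : ‖w‖ < 1 := by simpa using hw
  have hz' : ‖z‖ = 1 := by simpa using hz
  rw [poissonKernel_def, sub_zero, sub_zero, hz']
  refine div_nonneg ?_ (by positivity)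
  nlinarith [norm_nonneg w]

lemma continuousOn_poissonKernel {w : ℂ} (hw : w ∈ ball (0:ℂ) 1) :
    ContinuousOn (poissonKernel 0 w) (sphere (0:ℂ) 1) := by
  have hw' : ‖w‖ < 1 := by simpa using hw
  unfold poissonKernel
  refine ContinuousOn.div (by fun_prop) (by fun_prop) fun z hz => ?_
  have hz' : ‖z‖ = 1 := by simpa using hz
  have : z ≠ w := by rintro rfl; linarith
  simpa [sub_eq_zero] using this

lemma circleAverage_poissonKernel {w : ℂ} (hw : w ∈ ball (0:ℂ) 1) :
    circleAverage (poissonKernel 0 w) 0 1 = 1 := by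
  have h := InnerProductSpace.HarmonicOnNhd.circleAverage_poissonKernel_smul
    (f := fun _ : ℂ => (1:ℝ)) (c := 0) (R := 1) (fun _ _ => InnerProductSpace.harmonicAt_const 1) hw
  convert h using 2
  ext z
  simp

lemma norm_rpow_le_circleAverage_poissonKernel {F : ℂ → ℂ} (hF : DiffContOnCl ℂ F (ball 0 1))
    {s : ℝ} (hs : 0 < s) {w : ℂ} (hw : w ∈ ball (0:ℂ) 1) :
    ‖F w‖ ^ s ≤ circleAverage (fun z => poissonKernel 0 w z * ‖F z‖ ^ s) 0 1 := by
  have hcl : closure (ball (0:ℂ) 1) = closedBall 0 1 := closure_ball 0 one_ne_zero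
  have hFc : ContinuousOn F (sphere (0:ℂ) 1) :=
    hF.continuousOn.mono (by rw [hcl]; exact sphere_subset_closedBall)
  have hPc := continuousOn_poissonKernel hw
  have hone : circleAverage (poissonKernel 0 w) 0 1 = 1 :=
    circleAverage_poissonKernel hw
  have key : ∀ ε > 0, ‖F w‖ ^ s ≤ rexp (2 * ε) *
      (circleAverage (fun z => poissonKernel 0 w z * ‖F z‖ ^ s) 0 1 + ε) := by
    intro ε hε
    have hpos : ∀ z, 0 < ‖F z‖ ^ s + ε := fun z => by positivity
    have hvc : ContinuousOn (fun z => ‖F z‖ ^ s + ε) (sphere (0:ℂ) 1) :=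
      (hFc.norm.rpow_const fun _ _ => Or.inr hs.le).add continuousOn_const
    obtain ⟨Q, hQ, hvQ⟩ := exists_entire_re_approx_on_sphere
      (hvc.log fun z _ => (hpos z).ne') hε
    have hmax : ‖F w * Complex.exp (-(Q w) / s)‖ ≤ rexp (ε / s) := by
      refine Complex.norm_le_of_forall_mem_frontier_norm_le (U := ball 0 1)
        (f := fun z => F z * Complex.exp (-(Q z) / s)) isBounded_ball ?_ ?_ (subset_closure hw)
      · exact hF.smul (Differentiable.diffContOnCl (by fun_prop))
      · intro z hz
        rw [frontier_ball _ one_ne_zero] at hz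
        have h1 := (abs_le.1 (hvQ z hz)).2
        have h2 : ‖F z‖ ^ s ≤ rexp (ε + (Q z).re) :=
          calc ‖F z‖ ^ s ≤ ‖F z‖ ^ s + ε := by linarith
            _ = rexp (log (‖F z‖ ^ s + ε)) := (Real.exp_log (hpos z)).symm
            _ ≤ _ := Real.exp_le_exp.2 (by linarith)
        have h3 : ‖F z‖ ≤ rexp ((ε + (Q z).re) / s) := by
          have := Real.rpow_le_rpow (by positivity) h2 (one_div_pos.2 hs).le
          rwa [← Real.rpow_mul (norm_nonneg _), mul_one_div_cancel hs.ne', Real.rpow_one,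
            ← Real.exp_mul, mul_one_div] at this
        rw [norm_mul, Complex.norm_exp, Complex.div_ofReal_re, Complex.neg_re]
        calc _ ≤ rexp ((ε + (Q z).re) / s) * rexp (-(Q z).re / s) := by gcongr
          _ = _ := by rw [← Real.exp_add]; congr 1; ring
    have hFQ : ‖F w‖ ^ s ≤ rexp ε * ‖Complex.exp (Q w)‖ := by
      rw [norm_mul, Complex.norm_exp, Complex.div_ofReal_re, Complex.neg_re] at hmax
      have h3 : ‖F w‖ ≤ rexp ((ε + (Q w).re) / s) := by
        calc ‖F w‖ = ‖F w‖ * rexp (-(Q w).re / s) * rexp ((Q w).re / s) := by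
              rw [mul_assoc, ← Real.exp_add]; simp [neg_div]
          _ ≤ rexp (ε / s) * rexp ((Q w).re / s) := by gcongr
          _ = _ := by rw [← Real.exp_add]; congr 1; ring
      calc ‖F w‖ ^ s ≤ rexp ((ε + (Q w).re) / s) ^ s := by gcongr
        _ = _ := by
          rw [← Real.exp_mul, Complex.norm_exp, ← Real.exp_add]; congr 1; field_simp
    have hPQ : ‖Complex.exp (Q w)‖ ≤
        circleAverage (fun z => poissonKernel 0 w z * ‖Complex.exp (Q z)‖) 0 1 := by
      have h := DiffContOnCl.circleAverage_poissonKernel_smul (c := 0) (R := 1)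
        (f := fun z => Complex.exp (Q z)) (Differentiable.diffContOnCl (by fun_prop)) hw
      rw [← h, circleAverage_def, circleAverage_def, norm_smul, smul_eq_mul,
        Real.norm_of_nonneg (by positivity)]
      gcongr
      refine (intervalIntegral.norm_integral_le_integral_norm (by positivity)).trans_eq ?_
      refine intervalIntegral.integral_congr fun θ _ => ?_
      simp [abs_of_nonneg (poissonKernel_nonneg_of_mem_sphere hw
        (circleMap_mem_sphere (0:ℂ) zero_le_one θ))]
    have hci : ∀ u : ℂ → ℝ, ContinuousOn u (sphere (0:ℂ) 1) →
        CircleIntegrable (fun z => poissonKernel 0 w z * u z) 0 1 := fun u hu =>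
      (hPc.mul hu).circleIntegrable zero_le_one
    have hmono : circleAverage (fun z => poissonKernel 0 w z * ‖Complex.exp (Q z)‖) 0 1 ≤
        circleAverage (fun z => rexp ε * (poissonKernel 0 w z * ‖F z‖ ^ s +
          ε * poissonKernel 0 w z)) 0 1 := by
      refine circleAverage_mono (hci _ (by have := hQ.continuous; fun_prop)) ?_ ?_
      · refine ContinuousOn.circleIntegrable zero_le_one ?_
        exact continuousOn_const.mul ((hPc.mul (hFc.norm.rpow_const fun _ _ => Or.inr hs.le)).add
          (continuousOn_const.mul hPc))
      · intro z hz
        rw [abs_one] at hz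
        have h1 := (abs_le.1 (hvQ z hz)).1
        have h2 : ‖Complex.exp (Q z)‖ ≤ rexp ε * (‖F z‖ ^ s + ε) := by
          rw [Complex.norm_exp, ← Real.exp_log (hpos z), ← Real.exp_add, Real.exp_le_exp]
          linarith
        have := mul_le_mul_of_nonneg_left h2 (poissonKernel_nonneg_of_mem_sphere hw hz)
        linarith
    have hsplit : circleAverage (fun z => rexp ε * (poissonKernel 0 w z * ‖F z‖ ^ s +
          ε * poissonKernel 0 w z)) 0 1 =
        rexp ε * (circleAverage (fun z => poissonKernel 0 w z * ‖F z‖ ^ s) 0 1 + ε) := by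
      have e1 := circleAverage_fun_smul (a := rexp ε) (c := (0:ℂ)) (R := 1)
        (f := fun z => poissonKernel 0 w z * ‖F z‖ ^ s + ε * poissonKernel 0 w z)
      have e2 := circleAverage_fun_smul (a := ε) (c := (0:ℂ)) (R := 1) (f := poissonKernel 0 w)
      have hi : CircleIntegrable (fun z => ε * poissonKernel 0 w z) 0 1 :=
        (continuousOn_const.mul hPc).circleIntegrable zero_le_one
      simp only [smul_eq_mul] at e1 e2
      rw [e1, circleAverage_fun_add (hci _ (hFc.norm.rpow_const fun _ _ => Or.inr hs.le))
        hi, e2, hone, mul_one]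
    rw [hsplit] at hmono
    calc _ ≤ rexp ε * (rexp ε *
        (circleAverage (fun z => poissonKernel 0 w z * ‖F z‖ ^ s) 0 1 + ε)) := by
          grw [hFQ, hPQ, hmono]
      _ = _ := by rw [← mul_assoc, ← Real.exp_add, two_mul]
  have hlim : Filter.Tendsto (fun ε : ℝ => rexp (2 * ε) *
      (circleAverage (fun z => poissonKernel 0 w z * ‖F z‖ ^ s) 0 1 + ε))
      (nhdsWithin 0 (Set.Ioi 0))
      (nhds (circleAverage (fun z => poissonKernel 0 w z * ‖F z‖ ^ s) 0 1)) := by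
    have : Continuous (fun ε : ℝ => rexp (2 * ε) *
      (circleAverage (fun z => poissonKernel 0 w z * ‖F z‖ ^ s) 0 1 + ε)) := by fun_prop
    simpa using (this.tendsto 0).mono_left nhdsWithin_le_nhds
  exact ge_of_tendsto hlim (Filter.eventually_of_mem self_mem_nhdsWithin key)

lemma sq_lintegral_mul_le {X : Type*} [MeasurableSpace X] {μ : Measure X} {a b : X → ℝ≥0∞}
    (ha : Measurable a) (hb : Measurable b) :
    (∫⁻ x, a x * b x ∂μ) ^ 2 ≤ (∫⁻ x, a x ^ 2 ∂μ) * ∫⁻ x, b x ^ 2 ∂μ := by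
  have h := ENNReal.lintegral_mul_le_Lp_mul_Lq μ Real.HolderConjugate.two_two
    ha.aemeasurable hb.aemeasurable
  simp only [Pi.mul_apply, ENNReal.rpow_two] at h
  calc _ ≤ ((∫⁻ x, a x ^ 2 ∂μ) ^ (1 / 2 : ℝ) * (∫⁻ x, b x ^ 2 ∂μ) ^ (1 / 2 : ℝ)) ^ 2 := by gcongr
    _ = _ := by
      rw [mul_pow, ← ENNReal.rpow_two, ← ENNReal.rpow_two, ← ENNReal.rpow_mul,
        ← ENNReal.rpow_mul]
      norm_num

lemma ENNReal.le_of_sq_le_mul {a b : ℝ≥0∞} (ha : a ≠ ∞) (h : a ^ 2 ≤ b * a) : a ≤ b := by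
  rcases eq_or_ne a 0 with rfl | h0
  · simp
  · rw [sq] at h
    exact (ENNReal.mul_le_mul_iff_left h0 ha).1 h

/-- Kolmogorov–Seliverstov–Plessner `TT*` argument: a kernel with
`∫ K(x,t) K(y,t) dt ≤ C (K(x,y) + K(y,x))` defines a bounded operator on `L²`. -/
lemma lintegral_sq_le_of_kernel {X : Type*} [MeasurableSpace X] {μ : Measure X}
    [IsFiniteMeasure μ] {K : X → X → ℝ≥0∞} (hK : Measurable (Function.uncurry K))
    {C D W : ℝ≥0∞} (hD : D ≠ ∞) (hW : W ≠ ∞) (hKD : ∀ x y, K x y ≤ D)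
    (hKK : ∀ x y, ∫⁻ t, K x t * K y t ∂μ ≤ C * (K x y + K y x))
    {v w : X → ℝ≥0∞} (hv : Measurable v) (hw : Measurable w) (hwW : ∀ x, w x ≤ W)
    (hwv : ∀ x, w x ≤ ∫⁻ t, K x t * v t ∂μ) :
    ∫⁻ x, w x ^ 2 ∂μ ≤ (4 * C ^ 2) * ∫⁻ x, v x ^ 2 ∂μ := by
  have hKx (x) : Measurable (K x) := hK.comp measurable_prodMk_left
  have hKy (y) : Measurable fun x => K x y := hK.comp measurable_prodMk_right
  have hKv (x) : Measurable fun t => K x t * v t := (hKx x).mul hv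
  have hKw (t) : Measurable fun x => K x t * w x := (hKy t).mul hw
  have hKKm (x y) : Measurable fun t => K x t * K y t := (hKx x).mul (hKx y)
  set S : X → ℝ≥0∞ := fun t => ∫⁻ x, K x t * w x ∂μ
  have hSm : Measurable S :=
    Measurable.lintegral_prod_left' (f := fun z : X × X => K z.1 z.2 * w z.1)
      (hK.mul (hw.comp measurable_fst))
  have hSfin : ∫⁻ t, S t ^ 2 ∂μ ≠ ∞ := by
    have hb (t) : S t ≤ D * W * μ Set.univ := by
      calc S t ≤ ∫⁻ _, D * W ∂μ := lintegral_mono fun x => mul_le_mul' (hKD x t) (hwW x)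
        _ = _ := lintegral_const _
    refine ne_top_of_le_ne_top ?_ (lintegral_mono fun t => pow_le_pow_left' (hb t) 2)
    rw [lintegral_const]
    finiteness
  have hwfin : ∫⁻ x, w x ^ 2 ∂μ ≠ ∞ := by
    refine ne_top_of_le_ne_top ?_ (lintegral_mono fun t => pow_le_pow_left' (hwW t) 2)
    rw [lintegral_const]
    finiteness
  have hwvS : ∫⁻ x, w x ^ 2 ∂μ ≤ ∫⁻ t, v t * S t ∂μ := by
    calc ∫⁻ x, w x ^ 2 ∂μ ≤ ∫⁻ x, ∫⁻ t, w x * (K x t * v t) ∂μ ∂μ := by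
          refine lintegral_mono fun x => ?_
          rw [lintegral_const_mul _ (hKv x), sq]
          exact mul_le_mul_right (hwv x) _
      _ = ∫⁻ t, ∫⁻ x, w x * (K x t * v t) ∂μ ∂μ := by
          refine lintegral_lintegral_swap (Measurable.aemeasurable ?_)
          exact (hw.comp measurable_fst).mul (hK.mul (hv.comp measurable_snd))
      _ = _ := by
          refine lintegral_congr fun t => ?_
          simp only [S]
          rw [← lintegral_const_mul _ (hKw t)]
          exact lintegral_congr fun x => by ring
  have hSS : ∫⁻ t, S t ^ 2 ∂μ ≤ 2 * C * ∫⁻ t, w t * S t ∂μ := by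
    have hsymm : ∫⁻ x, ∫⁻ y, w x * w y * K x y ∂μ ∂μ = ∫⁻ t, w t * S t ∂μ := by
      rw [lintegral_lintegral_swap]
      · refine lintegral_congr fun t => ?_
        simp only [S]
        rw [← lintegral_const_mul _ (hKw t)]
        exact lintegral_congr fun x => by ring
      · exact (((hw.comp measurable_fst).mul (hw.comp measurable_snd)).mul hK).aemeasurable
    have hsymm' : ∫⁻ x, ∫⁻ y, w x * w y * K y x ∂μ ∂μ = ∫⁻ t, w t * S t ∂μ := by
      refine lintegral_congr fun t => ?_
      simp only [S]
      rw [← lintegral_const_mul _ (hKw t)]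
      exact lintegral_congr fun x => by ring
    calc ∫⁻ t, S t ^ 2 ∂μ = ∫⁻ t, ∫⁻ x, ∫⁻ y, w x * w y * (K x t * K y t) ∂μ ∂μ ∂μ := by
          refine lintegral_congr fun t => ?_
          simp only [S]
          rw [sq, ← lintegral_mul_const _ (hKw t)]
          refine lintegral_congr fun x => ?_
          rw [← lintegral_const_mul _ (hKw t)]
          exact lintegral_congr fun y => by ring
      _ = ∫⁻ x, ∫⁻ t, ∫⁻ y, w x * w y * (K x t * K y t) ∂μ ∂μ ∂μ := by
          refine lintegral_lintegral_swap (Measurable.aemeasurable ?_)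
          refine Measurable.lintegral_prod_right'
            (f := fun z : (X × X) × X => w z.1.2 * w z.2 * (K z.1.2 z.1.1 * K z.2 z.1.1)) ?_
          exact ((hw.comp (by fun_prop)).mul (hw.comp (by fun_prop))).mul
            ((hK.comp (g := Function.uncurry K) (f := fun z : (X × X) × X => (z.1.2, z.1.1))
              (by fun_prop)).mul (hK.comp (f := fun z : (X × X) × X => (z.2, z.1.1))
              (by fun_prop)))
      _ = ∫⁻ x, ∫⁻ y, ∫⁻ t, w x * w y * (K x t * K y t) ∂μ ∂μ ∂μ := by
          refine lintegral_congr fun x => ?_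
          refine lintegral_lintegral_swap (Measurable.aemeasurable ?_)
          exact (measurable_const.mul (hw.comp measurable_snd)).mul
            (((hKx x).comp measurable_fst).mul (hK.comp measurable_swap))
      _ ≤ ∫⁻ x, ∫⁻ y, C * (w x * w y * K x y + w x * w y * K y x) ∂μ ∂μ := by
          refine lintegral_mono fun x => lintegral_mono fun y => ?_
          rw [lintegral_const_mul _ (hKKm x y)]
          calc _ ≤ w x * w y * (C * (K x y + K y x)) := mul_le_mul_right (hKK x y) _
            _ = _ := by ring
      _ = C * (∫⁻ x, ∫⁻ y, w x * w y * K x y ∂μ ∂μ + ∫⁻ x, ∫⁻ y, w x * w y * K y x ∂μ ∂μ) := by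
          have m1 : Measurable (fun z : X × X => w z.1 * w z.2 * K z.1 z.2) :=
            ((hw.comp measurable_fst).mul (hw.comp measurable_snd)).mul hK
          have m2 : Measurable (fun z : X × X => w z.1 * w z.2 * K z.2 z.1) :=
            ((hw.comp measurable_fst).mul (hw.comp measurable_snd)).mul (hK.comp measurable_swap)
          have m3 : Measurable fun x => ∫⁻ y, w x * w y * K x y ∂μ := m1.lintegral_prod_right'
          have m4 : Measurable fun x => ∫⁻ y, w x * w y * K y x ∂μ := m2.lintegral_prod_right'
          have m5 (x) : Measurable fun y => w x * w y * K x y := m1.comp measurable_prodMk_left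
          have m6 (x) : Measurable fun y => w x * w y * K y x := m2.comp measurable_prodMk_left
          simp_rw [← lintegral_add_left m3, lintegral_const_mul _ ((m5 _).fun_add (m6 _)),
            lintegral_add_left (m5 _)]
          rw [lintegral_const_mul _ (m3.fun_add m4)]
      _ = _ := by rw [hsymm, hsymm']; ring
  have hSw : ∫⁻ t, S t ^ 2 ∂μ ≤ (4 * C ^ 2) * ∫⁻ x, w x ^ 2 ∂μ := by
    refine ENNReal.le_of_sq_le_mul hSfin ?_
    calc _ ≤ (2 * C * ∫⁻ t, w t * S t ∂μ) ^ 2 := by gcongr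
      _ = 4 * C ^ 2 * (∫⁻ t, w t * S t ∂μ) ^ 2 := by ring
      _ ≤ 4 * C ^ 2 * ((∫⁻ x, w x ^ 2 ∂μ) * ∫⁻ t, S t ^ 2 ∂μ) := by
        gcongr; exact sq_lintegral_mul_le hw hSm
      _ = _ := by ring
  refine ENNReal.le_of_sq_le_mul hwfin ?_
  calc _ ≤ (∫⁻ t, v t * S t ∂μ) ^ 2 := by gcongr
    _ ≤ (∫⁻ x, v x ^ 2 ∂μ) * ∫⁻ t, S t ^ 2 ∂μ := sq_lintegral_mul_le hv hSm
    _ ≤ (∫⁻ x, v x ^ 2 ∂μ) * ((4 * C ^ 2) * ∫⁻ x, w x ^ 2 ∂μ) := by gcongr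
    _ = _ := by ring

/-- Measurable selection of a maximiser among finitely many functions. -/
lemma exists_measurable_argmax {X : Type*} [MeasurableSpace X] {h : ℝ → X → ℝ}
    {a : ℕ → ℝ} {n : ℕ} (hm : ∀ i ≤ n, Measurable (h (a i))) :
    ∃ ρ : X → ℝ, Measurable ρ ∧ Measurable (fun x => h (ρ x) x) ∧
      (∀ x, ∃ i ≤ n, ρ x = a i) ∧ ∀ i ≤ n, ∀ x, h (a i) x ≤ h (ρ x) x := by
  induction n with
  | zero =>
    refine ⟨fun _ => a 0, measurable_const, hm 0 le_rfl, fun _ => ⟨0, le_rfl, rfl⟩,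
      fun i hi x => ?_⟩
    rw [Nat.le_zero.1 hi]
  | succ n ih =>
    obtain ⟨ρ, hρ, hhρ, hmem, hmax⟩ := ih fun i hi => hm i (by omega)
    classical
    have hset : MeasurableSet {x | h (ρ x) x ≤ h (a (n + 1)) x} :=
      measurableSet_le hhρ (hm _ le_rfl)
    refine ⟨fun x => if h (ρ x) x ≤ h (a (n + 1)) x then a (n + 1) else ρ x,
      Measurable.ite hset measurable_const hρ, ?_, fun x => ?_, fun i hi x => ?_⟩
    · have : Measurable fun x =>
          if h (ρ x) x ≤ h (a (n + 1)) x then h (a (n + 1)) x else h (ρ x) x :=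
        Measurable.ite hset (hm _ le_rfl) hhρ
      refine (congrArg Measurable (funext fun x => ?_)).mp this
      dsimp only
      split_ifs <;> rfl
    · dsimp only
      split_ifs
      · exact ⟨n + 1, le_rfl, rfl⟩
      · obtain ⟨i, hi, h⟩ := hmem x
        exact ⟨i, by omega, h⟩
    · dsimp only
      rcases Nat.le_succ_iff.1 hi with hi | rfl
      · have := hmax i hi x
        split_ifs <;> linarith
      · split_ifs <;> linarith

lemma poissonKernel_le_nine_mul {r : ℝ} (hr : 0 ≤ r) (hr1 : r < 1) {a b c : ℂ} (ha : ‖a‖ = 1)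
    (hb : ‖b‖ = 1) (hc : ‖c‖ = 1) (h : ‖c - b‖ ≤ ‖a - b‖) :
    poissonKernel 0 (r * a) b ≤ 9 * poissonKernel 0 (r * a) c := by
  have hra : ‖(r : ℂ) * a‖ = r := by simp [ha, abs_of_nonneg hr]
  simp only [poissonKernel_def, sub_zero, hra, hb, hc]
  have hb0 : 1 - r ≤ ‖b - r * a‖ := by
    have := norm_sub_norm_le b (r * a); rwa [hra, hb] at this
  have hc0 : 1 - r ≤ ‖c - r * a‖ := by
    have := norm_sub_norm_le c (r * a); rwa [hra, hc] at this
  have hab : ‖a - b‖ ≤ 2 * ‖b - r * a‖ := by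
    have h1 : ‖a - r * a‖ = 1 - r := by
      rw [show a - r * a = ((1 - r : ℝ) : ℂ) * a by push_cast; ring, norm_mul, ha, mul_one,
        Complex.norm_of_nonneg (by linarith)]
    have h2 := norm_sub_le (a - r * a) (b - r * a)
    rw [sub_sub_sub_cancel_right] at h2
    linarith
  have hcr : ‖c - r * a‖ ≤ 3 * ‖b - r * a‖ := by
    have h2 := norm_add_le (c - b) (b - r * a)
    rw [sub_add_sub_cancel] at h2
    linarith
  have hbpos : 0 < ‖b - r * a‖ := by linarith
  have hcpos : 0 < ‖c - r * a‖ := by linarith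
  rw [← mul_div_assoc, div_le_div_iff₀ (by positivity) (by positivity)]
  have hsq : ‖c - r * a‖ ^ 2 ≤ 9 * ‖b - r * a‖ ^ 2 := by nlinarith
  have hn : 0 ≤ 1 ^ 2 - r ^ 2 := by nlinarith
  nlinarith [mul_le_mul_of_nonneg_left hsq hn]

lemma ofReal_mul_mem_ball_s13 {r : ℝ} (hr : 0 ≤ r) (hr1 : r < 1) {a : ℂ} (ha : ‖a‖ = 1) :
    (r : ℂ) * a ∈ ball (0:ℂ) 1 := by
  simpa [ha, abs_of_nonneg hr] using hr1

lemma poissonKernel_mul_poissonKernel_le {r r' : ℝ} (hr : 0 ≤ r) (hr1 : r < 1) (hr' : 0 ≤ r')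
    (hr1' : r' < 1) {a a' b : ℂ} (ha : ‖a‖ = 1) (ha' : ‖a'‖ = 1) (hb : ‖b‖ = 1) :
    poissonKernel 0 (r * a) b * poissonKernel 0 (r' * a') b ≤
      9 * (poissonKernel 0 (r * a) a' * poissonKernel 0 (r' * a') b +
        poissonKernel 0 (r' * a') a * poissonKernel 0 (r * a) b) := by
  have n0 {z : ℂ} (hz : ‖z‖ = 1) : 0 ≤ poissonKernel 0 (r * a) z :=
    poissonKernel_nonneg_of_mem_sphere (ofReal_mul_mem_ball_s13 hr hr1 ha) (by simpa using hz)
  have n1 {z : ℂ} (hz : ‖z‖ = 1) : 0 ≤ poissonKernel 0 (r' * a') z :=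
    poissonKernel_nonneg_of_mem_sphere (ofReal_mul_mem_ball_s13 hr' hr1' ha') (by simpa using hz)
  have m1 := mul_nonneg (n0 ha') (n1 hb)
  have m2 := mul_nonneg (n1 ha) (n0 hb)
  rcases le_total ‖a' - b‖ ‖a - b‖ with h | h
  · have := mul_le_mul_of_nonneg_right (poissonKernel_le_nine_mul hr hr1 ha hb ha' h) (n1 hb)
    linarith
  · have := mul_le_mul_of_nonneg_right (poissonKernel_le_nine_mul hr' hr1' ha' hb ha h) (n0 hb)
    linarith

lemma poissonKernel_le_two_div {r : ℝ} (hr : 0 ≤ r) (hr1 : r < 1) {a b : ℂ} (ha : ‖a‖ = 1)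
    (hb : ‖b‖ = 1) : poissonKernel 0 (r * a) b ≤ 2 / (1 - r) := by
  have hra : ‖(r : ℂ) * a‖ = r := by simp [ha, abs_of_nonneg hr]
  simp only [poissonKernel_def, sub_zero, hra, hb]
  have hb0 : 1 - r ≤ ‖b - r * a‖ := by
    have := norm_sub_norm_le b (r * a); rwa [hra, hb] at this
  have h1 : 0 < 1 - r := by linarith
  have hbpos : 0 < ‖b - r * a‖ := by linarith
  rw [div_le_div_iff₀ (by positivity) h1]
  have hsq : (1 - r) ^ 2 ≤ ‖b - r * a‖ ^ 2 := by gcongr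
  nlinarith [mul_pos h1 h1]

lemma continuous_poissonKernel_circleMap {w : ℂ} (hw : w ∈ ball (0:ℂ) 1) :
    Continuous fun t => poissonKernel 0 w (circleMap 0 1 t) :=
  (continuousOn_poissonKernel hw).comp_continuous (continuous_circleMap 0 1)
    (circleMap_mem_sphere (0:ℂ) zero_le_one)

lemma lintegral_poissonKernel {w : ℂ} (hw : w ∈ ball (0:ℂ) 1) :
    ∫⁻ t in Set.Ioc 0 (2 * π), ENNReal.ofReal (poissonKernel 0 w (circleMap 0 1 t)) =
      ENNReal.ofReal (2 * π) := by
  rw [← ofReal_integral_eq_lintegral_ofReal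
    ((continuous_poissonKernel_circleMap hw).integrableOn_Ioc)
    (ae_of_all _ fun t => poissonKernel_nonneg_of_mem_sphere hw
      (circleMap_mem_sphere (0:ℂ) zero_le_one t)),
    ← intervalIntegral.integral_of_le (by positivity)]
  have h := circleAverage_poissonKernel hw
  rw [circleAverage_def, smul_eq_mul, inv_mul_eq_iff_eq_mul₀ (by positivity), mul_one] at h
  rw [h]

lemma continuous_norm_comp_circleMap {F : ℂ → ℂ} (hF : ContinuousOn F (closedBall 0 1)) :
    Continuous fun t => ‖F (circleMap 0 1 t)‖ :=
  (hF.comp_continuous (continuous_circleMap 0 1)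
    fun t => circleMap_mem_closedBall (0:ℂ) zero_le_one t).norm

lemma measurable_comp_of_continuousOn_closedBall {X : Type*} [MeasurableSpace X] {F : ℂ → ℂ}
    (hF : ContinuousOn F (closedBall 0 1)) {u : X → ℂ} (hu : Measurable u)
    (hmem : ∀ x, u x ∈ closedBall (0:ℂ) 1) : Measurable fun x => F (u x) :=
  (continuousOn_iff_continuous_domRestrict.1 hF).measurable.comp (hu.subtype_mk (h := hmem))

lemma ofReal_norm_rpow_le_lintegral {F : ℂ → ℂ} (hF : DiffContOnCl ℂ F (ball 0 1))
    {s : ℝ} (hs : 0 < s) {w : ℂ} (hw : w ∈ ball (0:ℂ) 1) :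
    ENNReal.ofReal (‖F w‖ ^ s) ≤ ∫⁻ t in Set.Ioc 0 (2 * π),
      ENNReal.ofReal (poissonKernel 0 w (circleMap 0 1 t)) *
        (ENNReal.ofReal (‖F (circleMap 0 1 t)‖ ^ s) * ENNReal.ofReal (2 * π)⁻¹) := by
  have hFc : ContinuousOn F (closedBall 0 1) := by
    rw [← closure_ball (0:ℂ) one_ne_zero]; exact hF.continuousOn
  have h := norm_rpow_le_circleAverage_poissonKernel hF hs hw
  have hP (t : ℝ) := poissonKernel_nonneg_of_mem_sphere hw
    (circleMap_mem_sphere (0:ℂ) zero_le_one t)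
  rw [circleAverage_def, smul_eq_mul, ← intervalIntegral.integral_const_mul,
    intervalIntegral.integral_of_le (by positivity)] at h
  refine (ENNReal.ofReal_le_ofReal h).trans ?_
  rw [ofReal_integral_eq_lintegral_ofReal]
  · refine lintegral_mono fun t => ?_
    have := hP t
    dsimp only
    rw [← ENNReal.ofReal_mul (by positivity), ← ENNReal.ofReal_mul this]
    exact ENNReal.ofReal_le_ofReal (le_of_eq (by ring))
  · refine Continuous.integrableOn_Ioc ?_
    exact continuous_const.mul ((continuous_poissonKernel_circleMap hw).mul
      ((continuous_norm_comp_circleMap hFc).rpow_const fun _ => Or.inr hs.le))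
  · exact ae_of_all _ fun t => mul_nonneg (by positivity) (mul_nonneg (hP t) (by positivity))

/-- The radial maximal theorem for the disc, in linearised form. -/
lemma lintegral_norm_rpow_radial_le {F : ℂ → ℂ} (hF : DiffContOnCl ℂ F (ball 0 1))
    {p : ℝ} (hp : 0 < p) {ρ : ℝ → ℝ} (hρ : Measurable ρ) {ρ₀ : ℝ} (hρ₀ : ρ₀ < 1)
    (h0 : ∀ θ, 0 ≤ ρ θ) (h1 : ∀ θ, ρ θ ≤ ρ₀) :
    ∫⁻ θ in Set.Ioc 0 (2 * π), ENNReal.ofReal (‖F (ρ θ * circleMap 0 1 θ)‖ ^ p) ≤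
      324 * ∫⁻ θ in Set.Ioc 0 (2 * π), ENNReal.ofReal (‖F (circleMap 0 1 θ)‖ ^ p) := by
  have hFc : ContinuousOn F (closedBall 0 1) := by
    rw [← closure_ball (0:ℂ) one_ne_zero]; exact hF.continuousOn
  have hn (θ : ℝ) : ‖circleMap 0 1 θ‖ = 1 := by simp
  have hlt (θ : ℝ) : ρ θ < 1 := (h1 θ).trans_lt hρ₀
  have hball (θ : ℝ) : (ρ θ : ℂ) * circleMap 0 1 θ ∈ ball (0:ℂ) 1 :=
    ofReal_mul_mem_ball_s13 (h0 θ) (hlt θ) (hn θ)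
  have hP (θ t : ℝ) : 0 ≤ poissonKernel 0 (ρ θ * circleMap 0 1 θ) (circleMap 0 1 t) :=
    poissonKernel_nonneg_of_mem_sphere (hball θ) (circleMap_mem_sphere (0:ℂ) zero_le_one t)
  have hcm : Measurable (circleMap 0 1) := (continuous_circleMap 0 1).measurable
  have hu : Measurable fun θ : ℝ => (ρ θ : ℂ) * circleMap 0 1 θ :=
    (Complex.measurable_ofReal.comp hρ).mul hcm
  obtain ⟨K, hKdef⟩ : ∃ K : ℝ → ℝ → ℝ≥0∞, ∀ θ t, K θ t =
    ENNReal.ofReal (poissonKernel 0 (ρ θ * circleMap 0 1 θ) (circleMap 0 1 t)) :=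
    ⟨_, fun _ _ => rfl⟩
  have hK : Measurable (Function.uncurry K) := by
    simp only [Function.uncurry_def, hKdef, poissonKernel_def]
    refine Measurable.ennreal_ofReal ?_
    have m1 : Measurable fun x : ℝ × ℝ => circleMap 0 1 x.2 := hcm.comp measurable_snd
    have m2 : Measurable fun x : ℝ × ℝ => (ρ x.1 : ℂ) * circleMap 0 1 x.1 :=
      hu.comp measurable_fst
    fun_prop
  obtain ⟨M, hM⟩ := (isCompact_closedBall (0:ℂ) 1).exists_bound_of_continuousOn hFc
  have hKK (θ φ : ℝ) : ∫⁻ t in Set.Ioc 0 (2 * π), K θ t * K φ t ≤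
      9 * ENNReal.ofReal (2 * π) * (K θ φ + K φ θ) := by
    have hmK (θ) : Measurable (K θ) := hK.comp measurable_prodMk_left
    have hint (θ) : ∫⁻ t in Set.Ioc 0 (2 * π), K θ t = ENNReal.ofReal (2 * π) := by
      simp only [hKdef, lintegral_poissonKernel (hball θ)]
    calc _ ≤ ∫⁻ t in Set.Ioc 0 (2 * π), (9 * K θ φ * K φ t + 9 * K φ θ * K θ t) := by
          refine lintegral_mono fun t => ?_
          have := ENNReal.ofReal_le_ofReal (poissonKernel_mul_poissonKernel_le (h0 θ) (hlt θ)
            (h0 φ) (hlt φ) (hn θ) (hn φ) (hn t))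
          rw [ENNReal.ofReal_mul (hP θ t), ENNReal.ofReal_mul (by norm_num),
            ENNReal.ofReal_add (mul_nonneg (hP _ _) (hP _ _)) (mul_nonneg (hP _ _) (hP _ _)),
            ENNReal.ofReal_mul (hP _ _), ENNReal.ofReal_mul (hP _ _), ENNReal.ofReal_ofNat] at this
          simp only [← hKdef] at this
          exact this.trans_eq (by ring)
      _ = _ := by
          rw [lintegral_add_left ((hmK φ).const_mul _), lintegral_const_mul _ (hmK φ),
            lintegral_const_mul _ (hmK θ), hint, hint]
          ring
  have hKD (θ t : ℝ) : K θ t ≤ ENNReal.ofReal (2 / (1 - ρ₀)) := by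
    rw [hKdef]
    refine ENNReal.ofReal_le_ofReal ?_
    refine (poissonKernel_le_two_div (h0 θ) (hlt θ) (hn θ) (hn t)).trans ?_
    have := h1 θ
    have : 0 < 1 - ρ₀ := by linarith
    gcongr
  have hmain := lintegral_sq_le_of_kernel (μ := volume.restrict (Set.Ioc 0 (2 * π))) hK
    (D := ENNReal.ofReal (2 / (1 - ρ₀))) (W := ENNReal.ofReal (M ^ (p / 2)))
    ENNReal.ofReal_ne_top ENNReal.ofReal_ne_top hKD hKK
    (v := fun t => ENNReal.ofReal (‖F (circleMap 0 1 t)‖ ^ (p / 2)) * ENNReal.ofReal (2 * π)⁻¹)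
    (w := fun θ => ENNReal.ofReal (‖F (ρ θ * circleMap 0 1 θ)‖ ^ (p / 2)))
    ((((continuous_norm_comp_circleMap hFc).measurable.pow_const _).ennreal_ofReal).mul_const _)
    ((measurable_comp_of_continuousOn_closedBall hFc hu
      fun θ => ball_subset_closedBall (hball θ)).norm.pow_const _).ennreal_ofReal
    (fun θ => ENNReal.ofReal_le_ofReal (Real.rpow_le_rpow (norm_nonneg _)
      (hM _ (ball_subset_closedBall (hball θ))) (by positivity)))
    (fun θ => by simpa only [hKdef] using
      ofReal_norm_rpow_le_lintegral hF (half_pos hp) (hball θ))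
  have hsq (x : ℝ) (hx : 0 ≤ x) : ENNReal.ofReal (x ^ (p / 2)) ^ 2 = ENNReal.ofReal (x ^ p) := by
    rw [← ENNReal.ofReal_pow (by positivity), ← Real.rpow_natCast, ← Real.rpow_mul hx]
    congr 2
    push_cast
    ring
  simp only [mul_pow, hsq _ (norm_nonneg _)] at hmain
  rw [lintegral_mul_const _
    ((continuous_norm_comp_circleMap hFc).measurable.pow_const _).ennreal_ofReal] at hmain
  refine hmain.trans_eq ?_
  have hone : ENNReal.ofReal (2 * π) ^ 2 * ENNReal.ofReal (2 * π)⁻¹ ^ 2 = 1 := by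
    rw [← mul_pow, ← ENNReal.ofReal_mul (by positivity), mul_inv_cancel₀ (by positivity)]
    simp
  calc _ = 4 * 9 ^ 2 * (ENNReal.ofReal (2 * π) ^ 2 * ENNReal.ofReal (2 * π)⁻¹ ^ 2) *
        ∫⁻ θ in Set.Ioc 0 (2 * π), ENNReal.ofReal (‖F (circleMap 0 1 θ)‖ ^ p) := by ring
    _ = _ := by rw [hone]; norm_num

lemma norm_rpow_le_div {F : ℂ → ℂ} (hF : DiffContOnCl ℂ F (ball 0 1)) {p : ℝ} (hp : 0 < p)
    {A : ℝ} (hA : ∫ θ in (0:ℝ)..(2 * π), ‖F (circleMap 0 1 θ)‖ ^ p ≤ A) {s : ℝ}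
    (hs : s ∈ Set.Ico (0:ℝ) 1) (θ : ℝ) : ‖F (s * circleMap 0 1 θ)‖ ^ p ≤ A / (1 - s) := by
  have hFc : ContinuousOn F (closedBall 0 1) := by
    rw [← closure_ball (0:ℂ) one_ne_zero]; exact hF.continuousOn
  have hn (θ : ℝ) : ‖circleMap 0 1 θ‖ = 1 := by simp
  have hw := ofReal_mul_mem_ball_s13 hs.1 hs.2 (hn θ)
  have hs1 : 0 < 1 - s := sub_pos.2 hs.2
  have hc : Continuous fun t => ‖F (circleMap 0 1 t)‖ ^ p :=
    (continuous_norm_comp_circleMap hFc).rpow_const fun _ => Or.inr hp.le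
  have hA0 : 0 ≤ A := le_trans
    (intervalIntegral.integral_nonneg (by positivity) fun t _ => by positivity) hA
  refine (norm_rpow_le_circleAverage_poissonKernel hF hp hw).trans ?_
  rw [circleAverage_def, smul_eq_mul]
  calc _ ≤ (2 * π)⁻¹ * ∫ t in (0:ℝ)..(2 * π), 2 / (1 - s) * ‖F (circleMap 0 1 t)‖ ^ p := by
        gcongr
        refine intervalIntegral.integral_mono_on (by positivity)
          (((continuous_poissonKernel_circleMap hw).mul hc).intervalIntegrable _ _)
          ((continuous_const.mul hc).intervalIntegrable _ _) fun t _ => ?_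
        gcongr
        exact poissonKernel_le_two_div hs.1 hs.2 (hn θ) (hn t)
    _ ≤ (2 * π)⁻¹ * (2 / (1 - s) * A) := by
        rw [intervalIntegral.integral_const_mul]
        gcongr
    _ = π⁻¹ * (A / (1 - s)) := by
        field_simp
    _ ≤ A / (1 - s) := by
        refine mul_le_of_le_one_left (by positivity) (inv_le_one_of_one_le₀ ?_)
        linarith [pi_gt_three]

/-- Up to an additive constant, the radial maximal function of `F` has a measurable majorant whose
`p`-th moment is controlled by the boundary values of `F`. -/
lemma exists_radial_majorant {F : ℂ → ℂ} (hF : DiffContOnCl ℂ F (ball 0 1)) {p : ℝ} (hp : 0 < p) :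
    ∃ m : ℝ → ℝ, (∀ θ, 0 ≤ m θ) ∧
      (∀ s ∈ Set.Ico (0:ℝ) 1, ∀ θ, ‖F (s * circleMap 0 1 θ)‖ ≤ m θ + 1) ∧
      IntervalIntegrable (fun θ => m θ ^ p) volume 0 (2 * π) ∧
      ∫ θ in (0:ℝ)..(2 * π), m θ ^ p ≤
        324 * ∫ θ in (0:ℝ)..(2 * π), ‖F (circleMap 0 1 θ)‖ ^ p := by
  have hFc : ContinuousOn F (closedBall 0 1) := by
    rw [← closure_ball (0:ℂ) one_ne_zero]; exact hF.continuousOn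
  have hn (θ : ℝ) : ‖circleMap 0 1 θ‖ = 1 := by simp
  obtain ⟨δ, hδ, hFδ⟩ := Metric.uniformContinuousOn_iff.1
    ((isCompact_closedBall (0:ℂ) 1).uniformContinuousOn_of_continuous hFc) 1 one_pos
  obtain ⟨n, hnδ⟩ := exists_nat_one_div_lt hδ
  have hN : (0:ℝ) < n + 1 := by positivity
  have hball {s : ℝ} (hs : s ∈ Set.Ico (0:ℝ) 1) (θ : ℝ) :
      (s : ℂ) * circleMap 0 1 θ ∈ closedBall (0:ℂ) 1 :=
    ball_subset_closedBall (ofReal_mul_mem_ball_s13 hs.1 hs.2 (hn θ))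
  have hgrid {i : ℕ} (hi : i ≤ n) :
      0 ≤ (i : ℝ) / (n + 1) ∧ (i : ℝ) / (n + 1) ≤ n / (n + 1) := by
    refine ⟨by positivity, ?_⟩
    gcongr
  have hlast : (n : ℝ) / (n + 1) < 1 := (div_lt_one hN).2 (lt_add_one _)
  have hcm : Measurable (circleMap 0 1) := (continuous_circleMap 0 1).measurable
  obtain ⟨ρ, hρ, hρm, hρi, hmax⟩ := exists_measurable_argmax
    (h := fun s θ => ‖F (s * circleMap 0 1 θ)‖) (a := fun i => (i : ℝ) / (n + 1)) (n := n)
    fun i hi => (measurable_comp_of_continuousOn_closedBall hFc (hcm.const_mul _)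
      fun θ => hball ⟨(hgrid hi).1, (hgrid hi).2.trans_lt hlast⟩ θ).norm
  have hρ0 (θ : ℝ) : 0 ≤ ρ θ := by
    obtain ⟨i, hi, h⟩ := hρi θ
    exact h ▸ (hgrid hi).1
  have hρ1 (θ : ℝ) : ρ θ ≤ n / (n + 1) := by
    obtain ⟨i, hi, h⟩ := hρi θ
    exact h ▸ (hgrid hi).2
  obtain ⟨M, hM⟩ := (isCompact_closedBall (0:ℂ) 1).exists_bound_of_continuousOn hFc
  have hint : IntegrableOn (fun θ => ‖F (ρ θ * circleMap 0 1 θ)‖ ^ p) (Set.Ioc 0 (2 * π)) := by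
    refine Integrable.of_bound (hρm.pow_const p).aestronglyMeasurable (M ^ p)
      (ae_of_all _ fun θ => ?_)
    rw [Real.norm_of_nonneg (by positivity)]
    exact Real.rpow_le_rpow (norm_nonneg _) (hM _ (hball ⟨hρ0 θ, (hρ1 θ).trans_lt hlast⟩ θ)) hp.le
  have hbd : IntegrableOn (fun θ => ‖F (circleMap 0 1 θ)‖ ^ p) (Set.Ioc 0 (2 * π)) :=
    ((continuous_norm_comp_circleMap hFc).rpow_const fun _ => Or.inr hp.le).integrableOn_Ioc
  refine ⟨fun θ => ‖F (ρ θ * circleMap 0 1 θ)‖, fun _ => norm_nonneg _, fun s hs θ => ?_,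
    (intervalIntegrable_iff_integrableOn_Ioc_of_le (by positivity)).2 hint, ?_⟩
  · set i := ⌊s * (n + 1)⌋₊ with hi
    have hsN : 0 ≤ s * (n + 1) := mul_nonneg hs.1 hN.le
    have h1 : (i : ℝ) ≤ s * (n + 1) := Nat.floor_le hsN
    have h2 : s * (n + 1) < i + 1 := Nat.lt_floor_add_one _
    have hin : i ≤ n := by
      have : (i : ℝ) < (n + 1 : ℕ) := by
        push_cast
        exact h1.trans_lt (mul_lt_of_lt_one_left hN hs.2)
      exact Nat.lt_succ_iff.1 (Nat.cast_lt.1 this)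
    have hdist : dist ((s : ℂ) * circleMap 0 1 θ)
        (((i : ℝ) / (n + 1) : ℝ) * circleMap 0 1 θ) < δ := by
      refine lt_of_le_of_lt ?_ hnδ
      rw [dist_eq_norm, ← sub_mul, norm_mul, hn, mul_one, ← Complex.ofReal_sub,
        Complex.norm_real, Real.norm_eq_abs, abs_le]
      have e : s - i / (n + 1) = (s * (n + 1) - i) / (n + 1) := by field_simp
      rw [e, ← neg_div]
      constructor <;> gcongr <;> linarith
    have h3 := hFδ _ (hball hs θ) _
      (hball ⟨(hgrid hin).1, (hgrid hin).2.trans_lt hlast⟩ θ) hdist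
    rw [dist_eq_norm] at h3
    have h4 := norm_sub_norm_le (F (s * circleMap 0 1 θ))
      (F (((i : ℝ) / (n + 1) : ℝ) * circleMap 0 1 θ))
    have h5 := hmax i hin θ
    linarith
  · have h := lintegral_norm_rpow_radial_le hF hp hρ hlast hρ0 hρ1
    rw [← ofReal_integral_eq_lintegral_ofReal hint (ae_of_all _ fun _ => by positivity),
      ← ofReal_integral_eq_lintegral_ofReal hbd (ae_of_all _ fun _ => by positivity),
      ← ENNReal.ofReal_ofNat, ← ENNReal.ofReal_mul (by norm_num),
      ENNReal.ofReal_le_ofReal_iff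
        (mul_nonneg (by norm_num) (integral_nonneg fun _ => by positivity))] at h
    rwa [intervalIntegral.integral_of_le (by positivity),
      intervalIntegral.integral_of_le (by positivity)]

lemma intervalIntegrable_mul_one_sub_rpow {φ : ℝ → ℝ} (hφ : ContinuousOn φ (Set.Icc 0 1)) {a : ℝ}
    (ha : -1 < a) : IntervalIntegrable (fun s => φ s * (1 - s) ^ a) volume 0 1 := by
  refine IntervalIntegrable.continuousOn_mul ?_ (by rwa [Set.uIcc_of_le zero_le_one])
  have := (intervalIntegral.intervalIntegrable_rpow' (a := 0) (b := 1) ha).comp_sub_left 1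
  simpa using this.symm

lemma norm_Vg_le {g f : ℂ → ℂ} {α C : ℝ} (hα : 0 < α) (hα1 : α ≤ 1)
    (hg : ∀ z ∈ ball (0:ℂ) 1, (1 - ‖z‖) ^ (1 - α) * ‖deriv g z‖ ≤ C)
    (hf : ContinuousOn f (ball 0 1)) {r : ℝ} (hr : r ∈ Set.Ico (0:ℝ) 1) {a : ℂ} (ha : ‖a‖ = 1) :
    ‖Vg g f (r * a)‖ ≤ C * ∫ s in (0:ℝ)..1, ‖f (r * (s * a))‖ * (1 - s) ^ (α - 1) := by
  have hnorm {s : ℝ} (hs : 0 ≤ s) : ‖(r : ℂ) * (s * a)‖ = r * s := by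
    simp [ha, abs_of_nonneg hr.1, abs_of_nonneg hs]
  have hmem {s : ℝ} (hs : s ∈ Set.Icc (0:ℝ) 1) : (r : ℂ) * (s * a) ∈ ball (0:ℂ) 1 := by
    rw [mem_ball_zero_iff, hnorm hs.1]
    exact (mul_le_of_le_one_right hr.1 hs.2).trans_lt hr.2
  have hint : IntervalIntegrable (fun s : ℝ => ‖f (r * (s * a))‖ * (1 - s) ^ (α - 1))
      volume 0 1 := by
    refine intervalIntegrable_mul_one_sub_rpow (ContinuousOn.norm ?_) (by linarith)
    exact hf.comp (by fun_prop) fun s hs => hmem hs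
  rw [Vg, norm_mul, ← intervalIntegral.integral_const_mul]
  refine (mul_le_of_le_one_left (norm_nonneg _) ?_).trans
    (intervalIntegral.norm_integral_le_of_norm_le zero_le_one ?_ (hint.const_mul C))
  · simpa [ha, abs_of_nonneg hr.1] using hr.2.le
  filter_upwards [Measure.ae_ne volume (1:ℝ)] with s hs1 hs
  have hs' : s < 1 := lt_of_le_of_ne hs.2 hs1
  have hz := hmem ⟨hs.1.le, hs.2⟩
  have h1 := hg _ hz
  rw [hnorm hs.1.le] at h1
  have hrs : r * s ≤ s := mul_le_of_le_one_left hs.1.le hr.2.le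
  have hpos : 0 < 1 - r * s := by linarith
  have hC : 0 ≤ C := le_trans (by positivity) h1
  have h2 : ‖deriv g (r * (s * a))‖ ≤ C * (1 - s) ^ (α - 1) :=
    calc ‖deriv g (r * (s * a))‖
        = (1 - r * s) ^ (1 - α) * ‖deriv g (r * (s * a))‖ * (1 - r * s) ^ (α - 1) := by
          rw [mul_right_comm, ← Real.rpow_add hpos]
          simp
      _ ≤ C * (1 - r * s) ^ (α - 1) := by gcongr
      _ ≤ C * (1 - s) ^ (α - 1) := by
          gcongr ?_ * ?_
          exact Real.rpow_le_rpow_of_nonpos (by linarith) (by linarith) (by linarith)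
  rw [show (s : ℂ) * (r * a) = r * (s * a) by ring, norm_mul]
  calc _ ≤ ‖f (r * (s * a))‖ * (C * (1 - s) ^ (α - 1)) := by gcongr
    _ = _ := by ring

lemma max_add_one_rpow_le {m b p : ℝ} (hm : 0 ≤ m) (hb : 0 ≤ b) (hp : 0 ≤ p) :
    max (m + 1) b ^ p ≤ 2 ^ p * (m ^ p + 1) + b ^ p := by
  have hmp := Real.rpow_nonneg hm p
  have hbp := Real.rpow_nonneg hb p
  have h2p : (0:ℝ) ≤ 2 ^ p := by positivity
  rcases le_total (m + 1) b with h | h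
  · rw [max_eq_right h]
    nlinarith
  · rw [max_eq_left h]
    rcases le_total m 1 with h1 | h1
    · have : (m + 1) ^ p ≤ 2 ^ p := Real.rpow_le_rpow (by linarith) (by linarith) hp
      nlinarith
    · have : (m + 1) ^ p ≤ (2 * m) ^ p := Real.rpow_le_rpow (by linarith) (by linarith) hp
      rw [Real.mul_rpow (by norm_num) hm] at this
      nlinarith

/-- The Hardy space bound for `V_g` on a single circle, with a constant not depending on the
radius. -/
lemma integral_norm_Vg_rpow_le {p q : ℝ} (hp : 1 ≤ p) (hpq : p < q) {g f : ℂ → ℂ} {C A : ℝ}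
    (hg : ∀ z ∈ ball (0:ℂ) 1, (1 - ‖z‖) ^ (1 - (1 / p - 1 / q)) * ‖deriv g z‖ ≤ C)
    (hf : DifferentiableOn ℂ f (ball 0 1)) {r : ℝ} (hr : r ∈ Set.Ico (0:ℝ) 1)
    (hA : ∫ θ in (0:ℝ)..(2 * π), ‖f (r * circleMap 0 1 θ)‖ ^ p ≤ A) :
    ∫ θ in (0:ℝ)..(2 * π), ‖Vg g f (r * circleMap 0 1 θ)‖ ^ q ≤
      (C * ((1 / (1 / p - 1 / q) + q) * (max A 1 ^ (1 / p)) ^ (1 - p / q))) ^ q *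
        (2 ^ p * (324 * A + 2 * π) + 2 * π * (max A 1 ^ (1 / p)) ^ p) := by
  have hp0 : 0 < p := by linarith
  have hq0 : 0 < q := by linarith
  have hα : 0 < 1 / p - 1 / q := sub_pos.2 (one_div_lt_one_div_of_lt hp0 hpq)
  have hα1 : 1 / p - 1 / q ≤ 1 := by
    have := (div_le_one hp0).2 hp
    have := one_div_pos.2 hq0
    linarith
  have hC : 0 ≤ C := le_trans (by simp) (hg 0 (by simp))
  have hn (θ : ℝ) : ‖circleMap 0 1 θ‖ = 1 := by simp
  have hmaps : Set.MapsTo (fun z : ℂ => (r : ℂ) * z) (closedBall 0 1) (ball 0 1) := fun z hz => by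
    rw [mem_closedBall_zero_iff] at hz
    rw [mem_ball_zero_iff, norm_mul, Complex.norm_of_nonneg hr.1]
    exact (mul_le_of_le_one_right hr.1 hz).trans_lt hr.2
  have hFc : ContinuousOn (fun z => f (r * z)) (closedBall 0 1) :=
    hf.continuousOn.comp (by fun_prop) hmaps
  have hF : DiffContOnCl ℂ (fun z => f (r * z)) (ball 0 1) :=
    ⟨hf.comp (by fun_prop) (hmaps.mono_left ball_subset_closedBall),
      by rwa [closure_ball (0:ℂ) one_ne_zero]⟩
  obtain ⟨m, hm0, hmF, hmint, hm⟩ := exists_radial_majorant hF hp0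
  set B := max A 1 ^ (1 / p) with hBdef
  have hA1 : 0 < max A 1 := lt_max_of_lt_right one_pos
  have hB : 0 < B := Real.rpow_pos_of_pos hA1 _
  set L := C * ((1 / (1 / p - 1 / q) + q) * B ^ (1 - p / q)) with hL
  have hL0 : 0 ≤ L := by positivity
  have hgrowth (θ : ℝ) : ∀ s ∈ Set.Ico (0:ℝ) 1,
      ‖f (r * (s * circleMap 0 1 θ))‖ ≤ B * (1 - s) ^ (-(1 / p)) := fun s hs => by
    have hs1 : 0 < 1 - s := sub_pos.2 hs.2
    have h1 : ‖f (r * (s * circleMap 0 1 θ))‖ ^ p ≤ max A 1 / (1 - s) :=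
      (norm_rpow_le_div hF hp0 hA hs θ).trans (by gcongr; exact le_max_left _ _)
    have h2 := Real.rpow_le_rpow (by positivity) h1 (one_div_pos.2 hp0).le
    rw [← Real.rpow_mul (norm_nonneg _), mul_one_div_cancel hp0.ne', Real.rpow_one,
      Real.div_rpow hA1.le hs1.le, div_eq_mul_inv, ← Real.rpow_neg hs1.le] at h2
    exact h2
  have hpt (θ : ℝ) : ‖Vg g f (r * circleMap 0 1 θ)‖ ^ q ≤
      L ^ q * (2 ^ p * (m θ ^ p + 1) + B ^ p) := by
    have hmax : 0 < max (m θ + 1) B := lt_max_of_lt_right hB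
    have h1 := integral_mul_one_sub_rpow_le_rpow hp0 hpq hB (fun s hs => hmF s hs θ) (hgrowth θ)
      (intervalIntegrable_mul_one_sub_rpow (ContinuousOn.norm (hFc.comp
        (g := fun z => f (r * z)) (f := fun s : ℝ => (s : ℂ) * circleMap 0 1 θ) (by fun_prop)
        fun s hs => by simpa [abs_of_nonneg hs.1] using hs.2)) (by linarith))
    have h2 := (norm_Vg_le hα hα1 hg hf.continuousOn hr (hn θ)).trans
      (mul_le_mul_of_nonneg_left h1 hC)
    calc _ ≤ (L * max (m θ + 1) B ^ (p / q)) ^ q := by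
          refine Real.rpow_le_rpow (norm_nonneg _) (h2.trans_eq ?_) hq0.le
          rw [hL]; ring
      _ = L ^ q * max (m θ + 1) B ^ p := by
          rw [Real.mul_rpow hL0 (by positivity), ← Real.rpow_mul hmax.le, div_mul_cancel₀ _ hq0.ne']
      _ ≤ _ := by
          gcongr
          exact max_add_one_rpow_le (hm0 θ) hB.le hp0.le
  have hint1 : IntervalIntegrable (fun θ => 2 ^ p * (m θ ^ p + 1)) volume 0 (2 * π) :=
    (hmint.add intervalIntegrable_const).const_mul _
  have hint2 : IntervalIntegrable (fun θ => L ^ q * (2 ^ p * (m θ ^ p + 1) + B ^ p))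
      volume 0 (2 * π) := (hint1.add intervalIntegrable_const).const_mul _
  calc _ ≤ ∫ θ in (0:ℝ)..(2 * π), L ^ q * (2 ^ p * (m θ ^ p + 1) + B ^ p) := by
        rw [intervalIntegral.integral_of_le (by positivity),
          intervalIntegral.integral_of_le (by positivity)]
        exact integral_mono_of_nonneg (ae_of_all _ fun θ => by positivity)
          ((intervalIntegrable_iff_integrableOn_Ioc_of_le (by positivity)).1 hint2)
          (ae_of_all _ hpt)
    _ = L ^ q * (2 ^ p * ((∫ θ in (0:ℝ)..(2 * π), m θ ^ p) + 2 * π) + 2 * π * B ^ p) := by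
        rw [intervalIntegral.integral_const_mul,
          intervalIntegral.integral_add hint1 intervalIntegrable_const,
          intervalIntegral.integral_const_mul,
          intervalIntegral.integral_add hmint intervalIntegrable_const]
        simp
    _ ≤ _ := by
        gcongr
        exact hm.trans (by gcongr)

/-- Let `1 ≤ p < q < ∞`, `α = 1/p − 1/q`, and let `g` be analytic on `𝔻` with
`sup_{z∈𝔻}(1−|z|)^{1−α}|g'(z)| < ∞` (i.e. `g ∈ Λ_α`). Then `V_g` maps `H^p` into `H^q`;
that is, `H^p ⊆ [V_g, H^q]`. -/
theorem Hp_subset_optimalDomain_Hq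
    (p q : ℝ) (hp : 1 ≤ p) (hpq : p < q)
    (g : ℂ → ℂ) (hg : DifferentiableOn ℂ g (ball (0:ℂ) 1))
    (hΛ : ∃ C : ℝ, ∀ z ∈ ball (0:ℂ) 1,
      (1 - ‖z‖) ^ (1 - (1 / p - 1 / q)) * ‖deriv g z‖ ≤ C) :
    ∀ f : ℂ → ℂ, DifferentiableOn ℂ f (ball (0:ℂ) 1) → memHp p f → memHp q (Vg g f) := by
  obtain ⟨C, hC⟩ := hΛ
  rintro f hf ⟨A, hA⟩
  have he (θ : ℝ) : Complex.exp (θ * Complex.I) = circleMap 0 1 θ := by simp [circleMap]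
  simp only [memHp, he] at hA ⊢
  exact ⟨_, fun r hr => integral_norm_Vg_rpow_le hp hpq hC hf hr (hA r hr)⟩
end
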